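/- arXiv:0904.1939 — 2 statements merged into one kernel-verified Lean document; each statement's English description precedes it below -/
import Mathlib

section
/- Let A be a unital semisimple commutative Banach algebra and B a unital commutative Banach algebra. If there exists a surjective group homomorphism T : A⁻¹ → B⁻¹ with σ(Tf) = σ(f) for all f ∈ A⁻¹, then B is semisimple and T extends to an algebra isomorphism from A onto B. -/
open NormedSpace WeakDual

section
variable {A : Type*} [NormedCommRing A] [NormedAlgebra ℂ A] [CompleteSpace A]

theorem E_add (a b : A) : exp (a + b) = exp a * exp b := by
  let _ := NormedAlgebra.restrictScalars ℚ ℂ A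
  exact exp_add

theorem E_cont : Continuous (exp : A → A) := by
  let _ := NormedAlgebra.restrictScalars ℚ ℂ A
  exact exp_continuous

theorem char_cont (φ : A →ₐ[ℂ] ℂ) : Continuous φ := by
  exact map_continuous φ

theorem char_E (φ : A →ₐ[ℂ] ℂ) (a : A) : φ (exp a) = Complex.exp (φ a) := by
  let _ := NormedAlgebra.restrictScalars ℚ ℂ A
  rw [Complex.exp_eq_exp_ℂ]
  exact map_exp φ (char_cont φ) a

noncomputable def EU (a : A) : Aˣ :=
  ⟨exp a, exp (-a), by rw [← E_add]; simp, by rw [← E_add]; simp⟩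

@[simp] theorem EU_coe (a : A) : ((EU a : Aˣ) : A) = exp a := rfl

theorem EU_add (a b : A) : EU (a + b) = EU a * EU b := Units.ext (E_add a b)

theorem EU_zero : EU (0 : A) = 1 := Units.ext (by simp)

theorem E_deriv (a : A) (z : ℂ) : HasDerivAt (fun z : ℂ => exp (z • a)) (exp (z • a) * a) z :=
  hasDerivAt_exp_smul_const a z

theorem E_surj (a : A) : ∃ (c : ℂ) (b : A), c ≠ 0 ∧ exp b = 1 + c • a := by
  have h := (hasStrictFDerivAt_exp_zero (𝕂 := ℂ) (𝔸 := A)).map_nhds_eq_of_surj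
    (LinearMap.range_eq_top.2 fun x => ⟨x, rfl⟩)
  have h1 : Set.range (exp : A → A) ∈ nhds (1 : A) := by
    have : Set.range (exp : A → A) ∈ Filter.map (exp : A → A) (nhds 0) :=
      Filter.range_mem_map
    rw [h] at this
    simpa using this
  have h2 : Filter.Tendsto (fun c : ℂ => 1 + c • a) (nhds 0) (nhds 1) := by
    have : Continuous (fun c : ℂ => 1 + c • a) := by fun_prop
    simpa using this.tendsto 0
  have h3 : ∀ᶠ c : ℂ in nhdsWithin 0 {0}ᶜ, 1 + c • a ∈ Set.range (exp : A → A) :=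
    (h2.eventually h1).filter_mono nhdsWithin_le_nhds
  obtain ⟨c, ⟨b, hb⟩, hc⟩ := (h3.and self_mem_nhdsWithin).exists
  exact ⟨c, b, hc, hb⟩

theorem spec_iff (a : A) (z : ℂ) : z ∈ spectrum ℂ a ↔ ∃ φ : A →ₐ[ℂ] ℂ, φ a = z := by
  rw [CharacterSpace.mem_spectrum_iff_exists]
  constructor
  · rintro ⟨f, hf⟩
    exact ⟨CharacterSpace.toAlgHom f, hf⟩
  · rintro ⟨f, hf⟩
    exact ⟨CharacterSpace.equivAlgHom.symm f, hf⟩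

def SS (A : Type*) [NormedCommRing A] [NormedAlgebra ℂ A] : Prop :=
  ∀ a : A, (∀ φ : A →ₐ[ℂ] ℂ, φ a = 0) → a = 0

theorem SS_ext (h : SS A) {a b : A} (hab : ∀ φ : A →ₐ[ℂ] ℂ, φ a = φ b) : a = b := by
  rw [← sub_eq_zero]
  exact h _ fun φ => by rw [map_sub, hab, sub_self]

theorem SS_iff : SS A ↔ ∀ a : A, spectralRadius ℂ a = 0 → a = 0 := by
  refine forall_congr' fun a => ?_
  have : (∀ φ : A →ₐ[ℂ] ℂ, φ a = 0) ↔ spectralRadius ℂ a = 0 := by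
    unfold spectralRadius
    simp only [ENNReal.iSup_eq_zero]
    constructor
    · intro h z hz
      obtain ⟨φ, rfl⟩ := (spec_iff a z).1 hz
      simp [h]
    · intro h φ
      simpa using h (φ a) ((spec_iff a _).2 ⟨φ, rfl⟩)
  rw [this]

theorem char_bound (φ : A →ₐ[ℂ] ℂ) (a : A) : ‖φ a‖ ≤ ‖a‖ * ‖(1 : A)‖ :=
  spectrum.norm_le_norm_mul_of_mem (AlgHom.apply_mem_spectrum φ a)

/-- lift -/
theorem exists_L (χ : Aˣ →* ℂ) (hχ : ∀ f : Aˣ, χ f ∈ spectrum ℂ (f : A)) :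
    ∃ L : A →L[ℝ] ℂ, (∀ a, χ (EU a) = Complex.exp (L a)) ∧ ∀ a, L a ∈ spectrum ℂ a := by
  have hne : ∀ f, χ f ≠ 0 := fun f => (Group.isUnit f).map χ |>.ne_zero
  have hadd : ∀ a b, χ (EU (a + b)) = χ (EU a) * χ (EU b) := fun a b => by
    rw [EU_add, map_mul]
  have hb : ∀ a : A, ‖χ (EU a) - 1‖ ≤ ‖exp a - 1‖ * ‖(1 : A)‖ := fun a => by
    obtain ⟨φ, hφ⟩ := (spec_iff _ _).1 (hχ (EU a))
    rw [← hφ]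
    simpa using char_bound φ (exp a - 1)
  have hc0 : Filter.Tendsto (fun a : A => χ (EU a)) (nhds 0) (nhds 1) := by
    rw [tendsto_iff_norm_sub_tendsto_zero]
    refine squeeze_zero (fun _ => norm_nonneg _) hb ?_
    have : Continuous fun a : A => ‖exp a - 1‖ * ‖(1 : A)‖ := by
      have := E_cont (A := A)
      fun_prop
    simpa using this.tendsto 0
  have hc : Continuous (fun a : A => χ (EU a)) := by
    rw [continuous_iff_continuousAt]
    intro a
    have h1 : Filter.Tendsto (fun b : A => χ (EU (b - a)) * χ (EU a)) (nhds a) (nhds (1 * χ (EU a))) := by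
      refine Filter.Tendsto.mul_const _ (hc0.comp ?_)
      have : Continuous fun b : A => b - a := by fun_prop
      simpa using this.tendsto a
    rw [one_mul] at h1
    refine h1.congr fun b => ?_
    rw [← hadd, sub_add_cancel]
  obtain ⟨F, ⟨hF0, hF⟩, huniq⟩ := Complex.isCoveringMapOn_exp.existsUnique_continuousMap_lifts
    (⟨_, hc⟩ : C(A, ℂ)) (a₀ := 0) (e₀ := 0) (by simp [EU_zero]) (fun a => hne _)
  have hF' : ∀ a, Complex.exp (F a) = χ (EU a) := fun a => congrFun hF a
  have hFadd : ∀ a b, F (a + b) = F a + F b := by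
    intro a b
    have h1 := huniq ⟨fun a => F (a + b) - F b, by fun_prop⟩ ⟨by simp, by
      funext a
      change Complex.exp (F (a + b) - F b) = χ (EU a)
      rw [Complex.exp_sub, hF', hF', hadd]
      exact mul_div_cancel_right₀ _ (hne _)⟩
    have h2 : F (a + b) - F b = F a := DFunLike.congr_fun h1 a
    rw [← h2]; ring
  let L : A →L[ℝ] ℂ := AddMonoidHom.toRealLinearMap ⟨⟨F, hF0⟩, hFadd⟩ F.continuous
  have hL : ∀ a, L a = F a := fun a => rfl
  refine ⟨L, fun a => (hF' a).symm, fun a => ?_⟩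
  obtain ⟨n, hn⟩ := exists_nat_gt (‖L a‖ + ‖a‖ * ‖(1 : A)‖)
  have hnpos : (0 : ℝ) < n := lt_of_le_of_lt (by positivity) hn
  have hn0 : (n : ℂ) ≠ 0 := by exact_mod_cast hnpos.ne'
  obtain ⟨φ, hφ⟩ := (spec_iff _ _).1 (hχ (EU ((n : ℝ)⁻¹ • a)))
  rw [← hF', ← hL, EU_coe, char_E, Complex.exp_eq_exp_iff_exists_int] at hφ
  obtain ⟨k, hk⟩ := hφ
  have hφs : φ ((n : ℝ)⁻¹ • a) = (n : ℂ)⁻¹ * φ a := by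
    have : ((n : ℝ)⁻¹ • a) = ((n : ℂ)⁻¹) • a := by
      rw [← Complex.coe_smul]; simp
    rw [this, map_smul, smul_eq_mul]
  rw [hφs, map_smul, Complex.real_smul] at hk
  push_cast at hk
  have hk2 : φ a - L a = n * (k * (2 * Real.pi * Complex.I)) := by
    field_simp at hk
    linear_combination hk
  have hk0 : k = 0 := by
    by_contra hne
    have h1 : ‖φ a - L a‖ < n := by
      refine lt_of_le_of_lt (norm_sub_le _ _) ?_
      have := char_bound φ a
      linarith
    rw [hk2] at h1
    have h2 : (1 : ℝ) ≤ |(k : ℝ)| := by exact_mod_cast Int.one_le_abs hne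
    simp [abs_of_pos Real.pi_pos] at h1
    have h3 := Real.pi_gt_three
    have h4 : (1 : ℝ) ≤ |(k : ℝ)| * (2 * Real.pi) := by nlinarith
    nlinarith
  rw [hk0] at hk2
  refine (spec_iff _ _).2 ⟨φ, ?_⟩
  simpa [sub_eq_zero] using hk2

theorem exists_MP (L : A →L[ℝ] ℂ) : ∃ M P : A →L[ℂ] ℂ,
    ∀ a, L a = M a + (starRingEnd ℂ) (P a) := by
  have hsm : ∀ (z : ℂ) (a : A), L (z • a) = z.re * L a + z.im * L (Complex.I • a) := by
    intro z a
    have : z • a = z.re • a + z.im • (Complex.I • a) := by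
      rw [← Complex.coe_smul, ← Complex.coe_smul, smul_smul, ← add_smul, Complex.re_add_im]
    rw [this, map_add, map_smul, map_smul, Complex.real_smul, Complex.real_smul]
  refine ⟨⟨⟨⟨fun a => (L a - Complex.I * L (Complex.I • a)) / 2, ?_⟩, ?_⟩, ?_⟩,
    ⟨⟨⟨fun a => (starRingEnd ℂ) ((L a + Complex.I * L (Complex.I • a)) / 2), ?_⟩, ?_⟩, ?_⟩, ?_⟩
  · intro x y
    simp only [smul_add, map_add]; ring
  · intro z a
    simp only [RingHom.id_apply, smul_eq_mul]
    rw [smul_smul, hsm z, hsm (Complex.I * z)]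
    simp only [Complex.mul_re, Complex.mul_im, Complex.I_re, Complex.I_im]
    conv_rhs => rw [← Complex.re_add_im z]
    push_cast
    linear_combination ((z.im : ℂ) * L (Complex.I • a) / 2) * Complex.I_sq
  · fun_prop
  · intro x y
    rw [← map_add]
    congr 1
    simp only [smul_add, map_add]; ring
  · intro z a
    simp only [RingHom.id_apply, smul_eq_mul]
    rw [smul_smul, hsm z, hsm (Complex.I * z)]
    simp only [Complex.mul_re, Complex.mul_im, Complex.I_re, Complex.I_im]
    rw [← Complex.conj_conj z, ← map_mul, Complex.conj_conj]
    congr 1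
    have : (starRingEnd ℂ) z = z.re - z.im * Complex.I := by
      apply Complex.ext <;> simp
    rw [this]
    push_cast
    linear_combination ((z.im : ℂ) * L (Complex.I • a) / 2) * Complex.I_sq
  · exact Complex.continuous_conj.comp (by fun_prop)
  · intro a
    change L a = (L a - Complex.I * L (Complex.I • a)) / 2 + (starRingEnd ℂ) ((starRingEnd ℂ) ((L a + Complex.I * L (Complex.I • a)) / 2))
    rw [Complex.conj_conj]; ring

theorem clinear (L : A →L[ℝ] ℂ) (hL : ∀ a, L a ∈ spectrum ℂ a) :
    ∃ M : A →L[ℂ] ℂ, ∀ a, L a = M a := by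
  obtain ⟨M, P, hMP⟩ := exists_MP L
  refine ⟨M, ?_⟩
  have hLs : ∀ (z : ℂ), L (z • (1 : A)) = z := by
    intro z
    obtain ⟨φ, hφ⟩ := (spec_iff _ _).1 (hL (z • (1 : A)))
    rw [← hφ]; simp
  have h1 : M 1 = 1 ∧ P 1 = 0 := by
    have e1 := hLs 1
    have e2 := hLs Complex.I
    rw [hMP] at e1 e2
    simp only [map_smul, smul_eq_mul, map_mul, one_smul, Complex.conj_I] at e1 e2
    have e3 : (starRingEnd ℂ) (P 1) = 0 := by
      linear_combination e1 / 2 + Complex.I * e2 / 2 + (-(M 1) / 2 + (starRingEnd ℂ) (P 1) / 2 + 1/2) * Complex.I_sq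
    rw [e3] at e1
    exact ⟨by simpa using e1, by simpa using e3⟩
  have hLu : ∀ f : Aˣ, L (f : A) ≠ 0 := by
    intro f h0
    have := hL (f : A)
    rw [h0] at this
    exact spectrum.zero_notMem ℂ f.isUnit this
  have hne : ∀ f : Aˣ, ‖M (f : A)‖ ≠ ‖P (f : A)‖ := by
    intro f hf
    by_cases hM : M (f : A) = 0
    · have hP : P (f : A) = 0 := by simpa [hM] using hf.symm
      exact hLu f (by rw [hMP, hM, hP]; simp)
    · obtain ⟨w, hw⟩ := IsAlgClosed.exists_pow_nat_eq (-(starRingEnd ℂ) (P (f : A)) / M (f : A))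
        (n := 2) (by norm_num)
      have hwn : ‖w‖ = 1 := by
        have : ‖w‖ ^ 2 = 1 := by
          rw [← norm_pow, hw, norm_div, norm_neg, RCLike.norm_conj, ← hf]
          exact div_self (by simpa using hM)
        nlinarith [norm_nonneg w]
      have hw0 : w ≠ 0 := by intro h; simp [h] at hwn
      have hcw : w * (starRingEnd ℂ) w = 1 := by
        rw [Complex.mul_conj, Complex.normSq_eq_norm_sq, hwn]; simp
      have hu := hLu (Units.mk0 w hw0 • f)
      apply hu
      have hs : ((Units.mk0 w hw0 • f : Aˣ) : A) = w • (f : A) := rfl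
      rw [hs, hMP, map_smul, map_smul, smul_eq_mul, smul_eq_mul, map_mul]
      have hw2 : w ^ 2 * M f = -(starRingEnd ℂ) (P f) := by
        rw [hw]; field_simp
      apply mul_left_cancel₀ hw0
      linear_combination hw2 + (starRingEnd ℂ) (P f) * hcw
  intro a
  have hdiff : ∀ Q : A →L[ℂ] ℂ, ∀ z : ℂ,
      HasDerivAt (fun z : ℂ => Q (exp (z • a))) (Q (exp (z • a) * a)) z := fun Q z =>
    Q.hasFDerivAt.comp_hasDerivAt z (E_deriv a z)
  have hlt : ∀ z : ℂ, ‖P (exp (z • a))‖ < ‖M (exp (z • a))‖ := by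
    by_contra! hcon
    obtain ⟨z, hz⟩ := hcon
    have hcont : Continuous fun z : ℂ => ‖M (exp (z • a))‖ - ‖P (exp (z • a))‖ := by
      have c1 : Continuous fun z : ℂ => M (exp (z • a)) :=
        continuous_iff_continuousAt.2 fun z => (hdiff M z).continuousAt
      have c2 : Continuous fun z : ℂ => P (exp (z • a)) :=
        continuous_iff_continuousAt.2 fun z => (hdiff P z).continuousAt
      exact c1.norm.sub c2.norm
    have := intermediate_value_univ z 0 hcont
    have h0 : (0 : ℝ) ∈ Set.Icc (‖M (exp (z • a))‖ - ‖P (exp (z • a))‖)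
        (‖M (exp ((0 : ℂ) • a))‖ - ‖P (exp ((0 : ℂ) • a))‖) := by
      simp only [zero_smul, exp_zero, h1.1, h1.2]
      constructor
      · linarith
      · simp
    obtain ⟨y, hy⟩ := this h0
    exact hne (EU (y • a)) (by simpa [sub_eq_zero] using hy)
  have hM0 : ∀ z : ℂ, M (exp (z • a)) ≠ 0 := by
    intro z h
    have := hlt z
    rw [h, norm_zero] at this
    exact absurd this (not_lt.2 (norm_nonneg _))
  have hP0 : ∀ z : ℂ, P (exp (z • a)) = 0 := by
    intro z
    have hd : Differentiable ℂ fun z : ℂ => P (exp (z • a)) / M (exp (z • a)) := fun z =>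
      ((hdiff P z).div (hdiff M z) (hM0 z)).differentiableAt
    have hbd : Bornology.IsBounded (Set.range fun z : ℂ => P (exp (z • a)) / M (exp (z • a))) := by
      rw [isBounded_iff_forall_norm_le]
      refine ⟨1, ?_⟩
      rintro _ ⟨z, rfl⟩
      simp only [norm_div]
      exact (div_le_one (norm_pos_iff.2 (hM0 z))).2 (hlt z).le
    have := hd.apply_eq_apply_of_bounded hbd z 0
    simp only [zero_smul, exp_zero, h1.2, zero_div, div_eq_zero_iff] at this
    exact this.resolve_right (hM0 z)
  have hPa : P a = 0 := by
    have h2 := hdiff P 0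
    simp only [hP0] at h2
    have := h2.unique (hasDerivAt_const 0 0)
    simpa using this
  rw [hMP, hPa]; simp

theorem gkz (M : A →L[ℂ] ℂ) (hM : ∀ a, M a ∈ spectrum ℂ a) : ∃ φ : A →ₐ[ℂ] ℂ, ∀ a, φ a = M a := by
  have h1 : M 1 = 1 := by
    obtain ⟨φ, hφ⟩ := (spec_iff _ _).1 (hM 1)
    rw [← hφ, map_one]
  have hMu : ∀ f : A, IsUnit f → M f ≠ 0 := by
    intro f hf h0
    have := hM f
    rw [h0] at this
    exact spectrum.zero_notMem ℂ hf this
  have hmul : ∀ b a, M (b * a) = M b * M a := by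
    intro b a
    have hdiff : ∀ b : A, ∀ z : ℂ,
        HasDerivAt (fun z : ℂ => M (b * exp (z • a))) (M (b * (exp (z • a) * a))) z := fun b z =>
      M.hasFDerivAt.comp_hasDerivAt z ((E_deriv a z).const_mul b)
    have hdiff1 : ∀ z : ℂ,
        HasDerivAt (fun z : ℂ => M (exp (z • a))) (M (exp (z • a) * a)) z := fun z =>
      M.hasFDerivAt.comp_hasDerivAt z (E_deriv a z)
    have hM0 : ∀ z : ℂ, M (exp (z • a)) ≠ 0 := fun z => hMu _ (EU (z • a)).isUnit
    have hbd : ∀ z : ℂ, M (b * exp (z • a)) / M (exp (z • a)) ∈ spectrum ℂ b := by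
      intro z
      set w := M (b * exp (z • a)) / M (exp (z • a)) with hw
      intro hr
      have hr' : IsUnit (algebraMap ℂ A w - b) := hr
      refine hMu _ (hr'.mul (EU (z • a)).isUnit) ?_
      rw [EU_coe, sub_mul, map_sub, ← Algebra.smul_def, map_smul, smul_eq_mul, hw,
        div_mul_cancel₀ _ (hM0 z), sub_self]
    have hconst : ∀ z : ℂ, M (b * exp (z • a)) = M b * M (exp (z • a)) := by
      intro z
      have hd : Differentiable ℂ fun z : ℂ => M (b * exp (z • a)) / M (exp (z • a)) := fun z =>
        ((hdiff b z).div (hdiff1 z) (hM0 z)).differentiableAt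
      have hb : Bornology.IsBounded
          (Set.range fun z : ℂ => M (b * exp (z • a)) / M (exp (z • a))) := by
        refine (spectrum.isBounded b).subset ?_
        rintro _ ⟨z, rfl⟩
        exact hbd z
      have := hd.apply_eq_apply_of_bounded hb z 0
      simp only [zero_smul, exp_zero, mul_one, h1, div_one] at this
      rwa [div_eq_iff (hM0 z)] at this
    have h2 := hdiff b 0
    simp only [hconst] at h2
    have := h2.unique ((hdiff1 0).const_mul (M b))
    simpa using this
  exact ⟨AlgHom.ofLinearMap M.toLinearMap h1 hmul, fun a => rfl⟩

theorem exists_char (χ : Aˣ →* ℂ) (hχ : ∀ f : Aˣ, χ f ∈ spectrum ℂ (f : A)) :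
    ∃ φ : A →ₐ[ℂ] ℂ, ∀ a, χ (EU a) = φ (exp a) := by
  obtain ⟨L, hL1, hL2⟩ := exists_L χ hχ
  obtain ⟨M, hM⟩ := clinear L hL2
  obtain ⟨φ, hφ⟩ := gkz M (fun a => hM a ▸ hL2 a)
  refine ⟨φ, fun a => ?_⟩
  rw [char_E, hφ, ← hM, hL1]

theorem exists_max (φ₁ : A →ₐ[ℂ] ℂ) (p v : A) (α : ℂ) (ε : ℝ) :
    ∃ φ₀ : A →ₐ[ℂ] ℂ, ∀ φ : A →ₐ[ℂ] ℂ,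
      ‖φ p - α‖ ^ 2 + ε * ‖φ v‖ ^ 2 ≤ ‖φ₀ p - α‖ ^ 2 + ε * ‖φ₀ v‖ ^ 2 := by
  have hc : ∀ a : A, Continuous fun φ : characterSpace ℂ A => φ a := fun a =>
    (gelfandTransform ℂ A a).continuous
  have hF : Continuous fun φ : characterSpace ℂ A => ‖φ p - α‖ ^ 2 + ε * ‖φ v‖ ^ 2 := by
    exact (((hc p).sub continuous_const).norm.pow 2).add
      (continuous_const.mul ((hc v).norm.pow 2))
  obtain ⟨φ₀, -, h⟩ := isCompact_univ.exists_isMaxOn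
    ⟨CharacterSpace.equivAlgHom.symm φ₁, Set.mem_univ _⟩ hF.continuousOn
  exact ⟨CharacterSpace.toAlgHom φ₀, fun φ =>
    h (Set.mem_univ (CharacterSpace.equivAlgHom.symm φ))⟩

theorem norm_one_add_le (y : ℂ) : ‖1 + y‖ ≤ Real.exp (y.re + ‖y‖ ^ 2 / 2) := by
  have h1 : ‖1 + y‖ ^ 2 = 1 + 2 * y.re + ‖y‖ ^ 2 := by
    rw [← Complex.normSq_eq_norm_sq, ← Complex.normSq_eq_norm_sq, Complex.normSq_apply,
      Complex.normSq_apply]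
    simp; ring
  have h2 : ‖1 + y‖ ^ 2 ≤ Real.exp (y.re + ‖y‖ ^ 2 / 2) ^ 2 := by
    rw [h1, ← Real.exp_nat_mul]
    have := Real.add_one_le_exp (((2 : ℕ) : ℝ) * (y.re + ‖y‖ ^ 2 / 2))
    refine le_trans (le_of_eq ?_) this
    push_cast; ring
  exact (pow_le_pow_iff_left₀ (norm_nonneg _) (Real.exp_pos _).le (by norm_num)).1 h2

theorem re_conj_mul_sub (x₀ x : ℂ) :
    2 * ((starRingEnd ℂ) x₀ * (x - x₀)).re = ‖x‖ ^ 2 - ‖x₀‖ ^ 2 - ‖x - x₀‖ ^ 2 := by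
  simp only [← Complex.normSq_eq_norm_sq, Complex.normSq_apply, Complex.mul_re, Complex.conj_re,
    Complex.conj_im, Complex.sub_re, Complex.sub_im]
  ring

theorem peak (u v : Aˣ) (h : ∀ b : A, spectrum ℂ ((u : A) * exp b) ⊆ spectrum ℂ ((v : A) * exp b))
    (p : A) (hp : (u : A) = p * v) (α : ℂ) (ε : ℝ) (hε : 0 < ε) (φ₀ : A →ₐ[ℂ] ℂ)
    (hmax : ∀ φ : A →ₐ[ℂ] ℂ,
      ‖φ p - α‖ ^ 2 + ε * ‖φ v‖ ^ 2 ≤ ‖φ₀ p - α‖ ^ 2 + ε * ‖φ₀ v‖ ^ 2)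
    (h1 : 1 ≤ ‖φ₀ p‖) : φ₀ p = 1 := by
  set c := φ₀ p with hc
  set w := φ₀ v with hw
  have hw0 : w ≠ 0 := (v.isUnit.map φ₀).ne_zero
  have hwn : 0 < ‖w‖ := norm_pos_iff.2 hw0
  set N : ℝ := 2 / (ε * ‖w‖ ^ 2) with hN
  have hNpos : 0 < N := by positivity
  set b : A := (-w⁻¹) • ((v : A) - algebraMap ℂ A w) + (N : ℂ) •
    ((starRingEnd ℂ) (c - α) • (p - algebraMap ℂ A c) +
      ((ε : ℂ) * (starRingEnd ℂ) w) • ((v : A) - algebraMap ℂ A w)) with hb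
  have hφb : ∀ φ : A →ₐ[ℂ] ℂ, φ b = -((φ v - w) / w) + (N : ℂ) *
      ((starRingEnd ℂ) (c - α) * ((φ p - α) - (c - α)) + (ε : ℂ) * ((starRingEnd ℂ) w * (φ v - w))) := by
    intro φ
    rw [hb]
    simp only [map_add, map_smul, map_sub, AlgHom.commutes, smul_eq_mul, Algebra.algebraMap_self,
      RingHom.id_apply]
    ring
  have hmem : c * w ∈ spectrum ℂ ((u : A) * exp b) := by
    refine (spec_iff _ _).2 ⟨φ₀, ?_⟩
    rw [map_mul, char_E, hφb, hp, map_mul]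
    simp [← hc, ← hw]
  obtain ⟨φ, hφ⟩ := (spec_iff _ _).1 (h b hmem)
  rw [map_mul, char_E] at hφ
  set y := (φ v - w) / w with hy
  have hvy : φ v = w * (1 + y) := by rw [hy]; field_simp; ring
  have hcy : (1 + y) * Complex.exp (φ b) = c := by
    apply mul_left_cancel₀ hw0
    rw [← mul_assoc, ← hvy, hφ, mul_comm]
  have hge : 1 ≤ Real.exp (y.re + ‖y‖ ^ 2 / 2 + (φ b).re) := by
    rw [Real.exp_add, ← Complex.norm_exp]
    refine h1.trans ?_
    rw [← hcy, norm_mul]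
    exact mul_le_mul_of_nonneg_right (norm_one_add_le y) (norm_nonneg _)
  have hge0 : 0 ≤ y.re + ‖y‖ ^ 2 / 2 + (φ b).re := by
    rwa [← Real.exp_zero, Real.exp_le_exp] at hge
  have hre : (φ b).re = -y.re + N * (((starRingEnd ℂ) (c - α) * ((φ p - α) - (c - α))).re +
      ε * ((starRingEnd ℂ) w * (φ v - w)).re) := by
    rw [hφb, Complex.add_re, Complex.neg_re, Complex.re_ofReal_mul, Complex.add_re,
      Complex.re_ofReal_mul]
  have e1 := re_conj_mul_sub (c - α) (φ p - α)
  have e2 := re_conj_mul_sub w (φ v)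
  have e3 := hmax φ
  have e4 : ‖φ v - w‖ ^ 2 = ‖w‖ ^ 2 * ‖y‖ ^ 2 := by
    rw [← mul_pow, ← norm_mul, hvy]; congr 2; ring
  have e5 : N * ε * ‖w‖ ^ 2 = 2 := by rw [hN]; field_simp
  have e6 : φ p - α - (c - α) = φ p - c := by ring
  have key : N * (2 * (((starRingEnd ℂ) (c - α) * ((φ p - α) - (c - α))).re +
      ε * ((starRingEnd ℂ) w * (φ v - w)).re)) ≤ N * (-‖φ p - c‖ ^ 2 - ε * ‖φ v - w‖ ^ 2) := by
    refine mul_le_mul_of_nonneg_left ?_ hNpos.le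
    rw [← e6]
    nlinarith
  have key2 : N * (ε * ‖φ v - w‖ ^ 2) = 2 * ‖y‖ ^ 2 := by
    rw [e4, ← e5]; ring
  have hsum : ‖y‖ ^ 2 + N * ‖φ p - c‖ ^ 2 ≤ 0 := by nlinarith
  have hy0 : y = 0 := by
    have : ‖y‖ ^ 2 ≤ 0 := by nlinarith [mul_nonneg hNpos.le (sq_nonneg ‖φ p - c‖)]
    have : ‖y‖ ^ 2 = 0 := le_antisymm this (sq_nonneg _)
    simpa using this
  have hp0 : φ p = c := by
    have : N * ‖φ p - c‖ ^ 2 ≤ 0 := by nlinarith [sq_nonneg ‖y‖]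
    have : ‖φ p - c‖ ^ 2 ≤ 0 := by
      by_contra! hh
      exact absurd this (not_le.2 (mul_pos hNpos hh))
    have : ‖φ p - c‖ ^ 2 = 0 := le_antisymm this (sq_nonneg _)
    simpa [sub_eq_zero] using this
  have hv0 : φ v = w := by rw [hvy, hy0]; ring
  rw [← hcy, hφb, hy0, hp0, hv0]
  simp

theorem char_sq_bound (φ : A →ₐ[ℂ] ℂ) (v : A) {δ : ℝ} (hδ : 0 < δ) :
    δ / ((‖v‖ * ‖(1 : A)‖) ^ 2 + 1) * ‖φ v‖ ^ 2 < δ := by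
  have h1 : ‖φ v‖ ^ 2 ≤ (‖v‖ * ‖(1 : A)‖) ^ 2 :=
    pow_le_pow_left₀ (norm_nonneg _) (char_bound φ v) 2
  rw [div_mul_eq_mul_div, div_lt_iff₀ (by positivity)]
  exact mul_lt_mul_of_pos_left (by linarith) hδ

theorem le_one_of_spec (u v : Aˣ)
    (h : ∀ b : A, spectrum ℂ ((u : A) * exp b) ⊆ spectrum ℂ ((v : A) * exp b))
    (p : A) (hp : (u : A) = p * v) (φ₁ : A →ₐ[ℂ] ℂ) : ‖φ₁ p‖ ≤ 1 := by
  by_contra! hcon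
  have hδ : 0 < ‖φ₁ p‖ ^ 2 - 1 := by nlinarith
  set ε := (‖φ₁ p‖ ^ 2 - 1) / ((‖(v : A)‖ * ‖(1 : A)‖) ^ 2 + 1) with hε
  have hεpos : 0 < ε := by positivity
  obtain ⟨φ₀, h₀⟩ := exists_max φ₁ p v 0 ε
  have hb := char_sq_bound φ₀ (v : A) hδ
  rw [← hε] at hb
  have hm := h₀ φ₁
  simp only [sub_zero] at hm
  have hlt : 1 < ‖φ₀ p‖ := by
    have : 0 ≤ ε * ‖φ₁ v‖ ^ 2 := by positivity
    nlinarith [norm_nonneg (φ₀ p)]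
  have := peak u v h p hp 0 ε hεpos φ₀ h₀ hlt.le
  rw [this] at hlt
  simp at hlt

theorem eq_of_spec (hA : SS A) (u v : Aˣ)
    (h : ∀ b : A, spectrum ℂ ((u : A) * exp b) = spectrum ℂ ((v : A) * exp b)) : u = v := by
  have hp : (u : A) = ((u * v⁻¹ : Aˣ) : A) * v := by simp
  have hq : (v : A) = ((v * u⁻¹ : Aˣ) : A) * u := by simp
  set p : A := ((u * v⁻¹ : Aˣ) : A) with hpdef
  have hn : ∀ φ : A →ₐ[ℂ] ℂ, 1 ≤ ‖φ p‖ := by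
    intro φ
    have h2 := le_one_of_spec v u (fun b => (h b).ge) _ hq φ
    have h3 : φ p * φ ((v * u⁻¹ : Aˣ) : A) = 1 := by
      rw [hpdef, ← map_mul, ← Units.val_mul]; simp
    have h4 : ‖φ p‖ * ‖φ ((v * u⁻¹ : Aˣ) : A)‖ = 1 := by rw [← norm_mul, h3]; simp
    nlinarith [norm_nonneg (φ p)]
  have h1 : ∀ φ : A →ₐ[ℂ] ℂ, φ p = 1 := by
    by_contra! hcon
    obtain ⟨φ₁, hφ₁⟩ := hcon
    have hδ : 0 < ‖φ₁ p - 1‖ ^ 2 := by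
      have : 0 < ‖φ₁ p - 1‖ := norm_pos_iff.2 (sub_ne_zero.2 hφ₁)
      positivity
    set ε := ‖φ₁ p - 1‖ ^ 2 / ((‖(v : A)‖ * ‖(1 : A)‖) ^ 2 + 1) with hε
    have hεpos : 0 < ε := by positivity
    obtain ⟨φ₀, h₀⟩ := exists_max φ₁ p v 1 ε
    have hb := char_sq_bound φ₀ (v : A) hδ
    rw [← hε] at hb
    have hm := h₀ φ₁
    have := peak u v (fun b => (h b).le) p hp 1 ε hεpos φ₀ h₀ (hn φ₀)
    rw [this] at hm
    have : 0 ≤ ε * ‖φ₁ v‖ ^ 2 := by positivity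
    simp at hm
    linarith
  have hp1 : p = 1 := SS_ext hA fun φ => by rw [h1, map_one]
  ext
  rw [hp, hp1, one_mul]

end

section
variable {A : Type*} [NormedCommRing A] [NormedAlgebra ℂ A] [CompleteSpace A]
variable {B : Type*} [NormedCommRing B] [NormedAlgebra ℂ B] [CompleteSpace B]

theorem exists_S (hB : SS B) (T : Aˣ →* Bˣ)
    (h : ∀ f : Aˣ, spectrum ℂ ((T f : B)) ⊆ spectrum ℂ ((f : A))) :
    ∃ S : A →ₐ[ℂ] B, ∀ a, S (exp a) = T (EU a) := by
  have hψ : ∀ ψ : B →ₐ[ℂ] ℂ, ∃ φ : A →ₐ[ℂ] ℂ, ∀ a, ψ (T (EU a)) = φ (exp a) := by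
    intro ψ
    exact exists_char ((ψ : B →* ℂ).comp ((Units.coeHom B).comp T))
      (fun f => h f (AlgHom.apply_mem_spectrum ψ _))
  choose Φ hΦ using hψ
  have hs : ∀ a : A, ∃ s : B, ∀ ψ, ψ s = Φ ψ a := by
    intro a
    obtain ⟨c, b, hc, hb⟩ := E_surj a
    refine ⟨c⁻¹ • ((T (EU b) : B) - 1), fun ψ => ?_⟩
    rw [map_smul, map_sub, map_one, hΦ, hb, map_add, map_one, map_smul]
    simp [hc]
  choose s hs using hs
  refine ⟨AlgHom.ofLinearMap ⟨⟨s, fun x y => SS_ext hB fun ψ => ?_⟩,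
    fun z x => SS_ext hB fun ψ => ?_⟩ (SS_ext hB fun ψ => ?_)
      (fun x y => SS_ext hB fun ψ => ?_), fun a => SS_ext hB fun ψ => ?_⟩
  · simp [hs]
  · simp [hs]
  · change ψ (s 1) = ψ 1
    simp [hs]
  · change ψ (s (x * y)) = ψ (s x * s y)
    simp [hs]
  · change ψ (s (exp a)) = _
    rw [hs, hΦ]

theorem S_E (hB : SS B) (S : A →ₐ[ℂ] B) (a : A) : S (exp a) = exp (S a) := by
  refine SS_ext hB fun ψ => ?_
  rw [char_E]
  exact char_E (ψ.comp S) a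

theorem S_inv (hA : SS A) (T : Aˣ → Bˣ) (T' : Bˣ → Aˣ) (hTT : ∀ g, T (T' g) = g)
    (S : A →ₐ[ℂ] B) (hS : ∀ a, S (exp a) = T (EU a))
    (S' : B →ₐ[ℂ] A) (hS' : ∀ a, S' (exp a) = T' (EU a)) (b : B) : S (S' b) = b := by
  have h1 : ∀ d : B, S (S' (exp d)) = exp d := by
    intro d
    rw [S_E hA, hS]
    have : EU (S' d) = T' (EU d) := by
      ext
      rw [EU_coe, ← S_E hA, hS']
    rw [this, hTT, EU_coe]
  obtain ⟨c, d, hc, hd⟩ := E_surj b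
  have := h1 d
  rw [hd] at this
  simp only [map_add, map_one, map_smul, add_right_inj] at this
  exact smul_right_injective _ hc this

end

theorem stmt13 {A B : Type*} [NormedCommRing A] [NormedAlgebra ℂ A] [CompleteSpace A]
    [NormedCommRing B] [NormedAlgebra ℂ B] [CompleteSpace B]
    (hA : ∀ a : A, spectralRadius ℂ a = 0 → a = 0)
    (T : Aˣ → Bˣ) (hsurj : Function.Surjective T)
    (hmul : ∀ f g : Aˣ, T (f * g) = T f * T g)
    (h : ∀ f : Aˣ, spectrum ℂ ((T f : B)) = spectrum ℂ ((f : A))) :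
    (∀ b : B, spectralRadius ℂ b = 0 → b = 0) ∧
    ∃ S : A ≃ₐ[ℂ] B, ∀ f : Aˣ, S (f : A) = ((T f : B)) := by
  have hA' : SS A := SS_iff.2 hA
  let T₀ : Aˣ →* Bˣ := MonoidHom.mk' T hmul
  have hT₀ : ∀ f, T₀ f = T f := fun f => rfl
  have hT1 : T 1 = 1 := map_one T₀
  have hone : ∀ f : Aˣ, (∀ ψ : B →ₐ[ℂ] ℂ, ψ (T f) = 1) → f = 1 := by
    intro f hf
    ext
    refine SS_ext hA' fun φ => ?_
    have h1 : φ f ∈ spectrum ℂ ((T f : B)) := by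
      rw [h]; exact AlgHom.apply_mem_spectrum φ _
    obtain ⟨ψ, hψ⟩ := (spec_iff _ _).1 h1
    rw [← hψ, hf]; simp
  have hB' : SS B := by
    intro b hb
    have hu : IsUnit (1 + b) := by
      by_contra hu
      obtain ⟨ψ, hψ⟩ := CharacterSpace.exists_apply_eq_zero hu
      have h2 := hb (CharacterSpace.toAlgHom ψ)
      have h3 : CharacterSpace.toAlgHom ψ (1 + b) = 0 := hψ
      rw [map_add, h2, map_one] at h3
      simp at h3
    obtain ⟨f, hf⟩ := hsurj hu.unit
    have : f = 1 := hone f fun ψ => by rw [hf]; simp [hb]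
    rw [this, hT1] at hf
    have := congrArg Units.val hf
    simpa using this
  have hinj : Function.Injective T₀ := by
    rw [injective_iff_map_eq_one]
    intro f hf
    exact hone f fun ψ => by rw [← hT₀, hf]; simp
  let Te : Aˣ ≃* Bˣ := MulEquiv.ofBijective T₀ ⟨hinj, hsurj⟩
  have hTe : ∀ f, Te f = T f := fun f => rfl
  have h' : ∀ g : Bˣ, spectrum ℂ ((Te.symm g : A)) = spectrum ℂ (g : B) := by
    intro g
    rw [← h, ← hTe, Te.apply_symm_apply]
  obtain ⟨S, hS⟩ := exists_S hB' (Te : Aˣ →* Bˣ) (fun f => (h f).le)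
  obtain ⟨S', hS'⟩ := exists_S hA' (Te.symm : Bˣ →* Aˣ) (fun f => (h' f).le)
  have i1 : ∀ b, S (S' b) = b := S_inv hA' Te Te.symm Te.apply_symm_apply S hS S' hS'
  have i2 : ∀ a, S' (S a) = a := S_inv hB' Te.symm Te Te.symm_apply_apply S' hS' S hS
  let Se : A ≃ₐ[ℂ] B := AlgEquiv.ofAlgHom S S' (AlgHom.ext i1) (AlgHom.ext i2)
  refine ⟨SS_iff.1 hB', Se, fun f => ?_⟩
  have key : Units.map (S' : B →* A) (T f) = f := by
    refine eq_of_spec hA' _ _ fun b => ?_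
    rw [← EU_coe, ← Units.val_mul f, ← h, hmul, ← AlgEquiv.spectrum_eq Se]
    congr 1
    change S (S' (T f) * exp b) = _
    rw [map_mul, i1, hS]
    rfl
  have : S' (T f) = f := congrArg Units.val key
  change S f = T f
  rw [← i1 (T f), this]
end

section
/- Let 𝒜 and ℬ be uniform algebras on compact Hausdorff spaces X and Y, and T : 𝒜⁻¹ → ℬ⁻¹ a surjective map with ‖TfTg − 1‖∞ = ‖fg − 1‖∞ for all f, g ∈ 𝒜⁻¹. Then (T1)² = 1 and there exist a homeomorphism φ : Ch(ℬ) → Ch(𝒜) and a clopen subset K of Ch(ℬ) such that Tf(y) = T1(y)·f(φ(y)) for y ∈ K and Tf(y) = T1(y)·conj(f(φ(y))) for y ∈ Ch(ℬ)∖K, for every f ∈ 𝒜⁻¹. In particular T/T1 extends to a real-algebra isomorphism from 𝒜 onto ℬ. -/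
/-- The peripheral spectrum of a continuous function on a compact space. -/
noncomputable def perSpec {X : Type*} [TopologicalSpace X] [CompactSpace X]
    (f : C(X, ℂ)) : Set ℂ :=
  {z | z ∈ Set.range f ∧ ‖z‖ = ‖f‖}

/-- A peak set for a subalgebra of C(X, ℂ). -/
def IsPeakSet {X : Type*} [TopologicalSpace X] [CompactSpace X]
    (A : Subalgebra ℂ C(X, ℂ)) (E : Set X) : Prop :=
  ∃ f ∈ A, perSpec f = {1} ∧ E = f ⁻¹' {1}

/-- The Choquet boundary (set of p-points): points x such that {x} is an
intersection of peak sets. -/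
def ChoquetBdry {X : Type*} [TopologicalSpace X] [CompactSpace X]
    (A : Subalgebra ℂ C(X, ℂ)) : Set X :=
  {x | ∃ P : Set (Set X), (∀ E ∈ P, IsPeakSet A E) ∧ ⋂₀ P = {x}}


open NormedSpace in
theorem bexp_add {𝔸 : Type*} [NormedCommRing 𝔸] [NormedAlgebra ℂ 𝔸] [CompleteSpace 𝔸] (x y : 𝔸) :
    exp (x + y) = exp x * exp y := by
  let _ : NormedAlgebra ℚ 𝔸 := NormedAlgebra.restrictScalars ℚ ℂ 𝔸
  exact NormedSpace.exp_add

/-- The exponential, as a unit. -/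
noncomputable def eU {𝔸 : Type*} [NormedCommRing 𝔸] [NormedAlgebra ℂ 𝔸] [CompleteSpace 𝔸]
    (x : 𝔸) : 𝔸ˣ where
  val := NormedSpace.exp x
  inv := NormedSpace.exp (-x)
  val_inv := by rw [← bexp_add]; simp
  inv_val := by rw [← bexp_add]; simp

section generic
variable {𝔸 : Type*} [NormedCommRing 𝔸] [NormedAlgebra ℂ 𝔸] [CompleteSpace 𝔸]
variable {𝔹 : Type*} [NormedCommRing 𝔹] [NormedAlgebra ℂ 𝔹] [CompleteSpace 𝔹]

theorem eU_add (x y : 𝔸) : eU (x + y) = eU x * eU y := Units.ext (bexp_add x y)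

theorem eU_zero : eU (0 : 𝔸) = 1 := Units.ext (by simp [eU])

theorem eU_neg (x : 𝔸) : eU (-x) = (eU x)⁻¹ := by
  apply eq_inv_of_mul_eq_one_left
  rw [← eU_add]; simp [eU_zero]

theorem eU_nsmul (n : ℕ) (x : 𝔸) : eU (n • x) = eU x ^ n := by
  induction n with
  | zero => simp [eU_zero]
  | succ n ih => rw [succ_nsmul, eU_add, ih, pow_succ]

theorem exp_loc (𝔸 : Type*) [NormedCommRing 𝔸] [NormedAlgebra ℂ 𝔸] [CompleteSpace 𝔸] :
    ∃ r > 0, (∀ v : 𝔸, ‖v‖ < r → eU v = 1 → v = 0) ∧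
      ∀ r' > 0, ∃ δ > 0, ∀ F : 𝔸, ‖F - 1‖ < δ → ∃ v : 𝔸, ‖v‖ < r' ∧ (eU v : 𝔸) = F := by
  have h0 : HasStrictFDerivAt (𝕜 := ℂ) (NormedSpace.exp : 𝔸 → 𝔸)
      ((ContinuousLinearEquiv.refl ℂ 𝔸 : 𝔸 ≃L[ℂ] 𝔸) : 𝔸 →L[ℂ] 𝔸) 0 := by
    have := hasStrictFDerivAt_exp_zero (𝕂 := ℂ) (𝔸 := 𝔸)
    exact this
  let e := h0.toOpenPartialHomeomorph
  have hs : e.source ∈ nhds (0 : 𝔸) :=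
    e.open_source.mem_nhds h0.mem_toOpenPartialHomeomorph_source
  obtain ⟨r, hr, hrs⟩ := Metric.mem_nhds_iff.1 hs
  refine ⟨r, hr, ?_, ?_⟩
  · intro v hv h1
    have hv' : v ∈ e.source := hrs (by simpa using hv)
    have h0' : (0 : 𝔸) ∈ e.source := hrs (by simpa using hr)
    apply e.injOn hv' h0'
    change NormedSpace.exp v = NormedSpace.exp 0
    have := congrArg Units.val h1
    simp only [eU, Units.val_one] at this
    rw [this]; simp
  · intro r' hr'
    have := h0.map_nhds_eq_of_equiv
    have h2 : NormedSpace.exp '' (Metric.ball (0 : 𝔸) r') ∈ nhds (NormedSpace.exp (0 : 𝔸)) := by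
      rw [← this]; exact Filter.image_mem_map (Metric.ball_mem_nhds _ hr')
    rw [NormedSpace.exp_zero] at h2
    obtain ⟨δ, hδ, hδs⟩ := Metric.mem_nhds_iff.1 h2
    refine ⟨δ, hδ, fun F hF => ?_⟩
    obtain ⟨v, hv, hvF⟩ := hδs (show F ∈ Metric.ball 1 δ by simpa [dist_eq_norm] using hF)
    exact ⟨v, by simpa using hv, hvF⟩

end generic

/-- The (non-symmetric) distance. -/
noncomputable def dd {𝔸 : Type*} [NormedCommRing 𝔸] (f g : 𝔸ˣ) : ℝ := ‖((f / g : 𝔸ˣ) : 𝔸) - 1‖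

theorem dd_eq_zero {𝔸 : Type*} [NormedCommRing 𝔸] {f g : 𝔸ˣ} (h : dd f g = 0) : f = g := by
  have h1 : ((f / g : 𝔸ˣ) : 𝔸) - 1 = 0 := norm_eq_zero.1 h
  have h2 : (f / g : 𝔸ˣ) = 1 := Units.ext (by simpa using sub_eq_zero.1 h1)
  exact div_eq_one.1 h2

theorem mu_aux {𝔸 : Type*} [NormedCommRing 𝔸] [NormedAlgebra ℂ 𝔸] (a b c : 𝔸ˣ) (habc : a * c = b * b)
    (h1 : dd a b ≤ 1 / 5) (h2 : dd b a ≤ 1 / 5) (n : ℕ) :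
    ∀ g : Equiv.Perm 𝔸ˣ, (∀ x y, dd (g x) (g y) = dd x y) → g a = a → g c = c →
      dd b (g b) ≤ (1 / 2) * (2 / 3) ^ n := by
  have base : ∀ g : Equiv.Perm 𝔸ˣ, (∀ x y, dd (g x) (g y) = dd x y) → g a = a → g c = c →
      dd b (g b) ≤ 1 / 2 := by
    intro g hg ga gc
    have h3 : dd a (g b) ≤ 1 / 5 := by
      have := hg a b
      rw [ga] at this; rw [this]; exact h1
    have e : ((b / g b : 𝔸ˣ) : 𝔸) - 1 = (((a / g b : 𝔸ˣ) : 𝔸) - 1) * (((b / a : 𝔸ˣ) : 𝔸) - 1)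
        + (((a / g b : 𝔸ˣ) : 𝔸) - 1) + (((b / a : 𝔸ˣ) : 𝔸) - 1) := by
      have : (b / g b : 𝔸ˣ) = (a / g b) * (b / a) := by
        rw [mul_comm, div_mul_div_cancel]
      rw [this, Units.val_mul]; ring
    unfold dd at *
    rw [e]
    refine (norm_add₃_le).trans ?_
    have := norm_mul_le (((a / g b : 𝔸ˣ) : 𝔸) - 1) (((b / a : 𝔸ˣ) : 𝔸) - 1)
    have h4 := mul_le_mul h3 h2 (norm_nonneg _) (by norm_num)
    linarith
  induction n with
  | zero => intro g hg ga gc; simpa using base g hg ga gc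
  | succ n ih =>
    intro g hg ga gc
    let ψ : Equiv.Perm 𝔸ˣ := Equiv.divLeft (b * b)
    have hψ : ∀ x, ψ x = b * b / x := fun x => rfl
    have hψψ : ∀ x, ψ (ψ x) = x := fun x => by rw [hψ, hψ, div_div_cancel]
    have hψd : ∀ x y, dd (ψ x) (ψ y) = dd y x := by
      intro x y
      unfold dd
      rw [hψ, hψ, div_div_div_cancel_left]
    have hψa : ψ a = c := by rw [hψ, ← habc, mul_div_cancel_left]
    have hψc : ψ c = a := by rw [← hψa, hψψ]
    have hψb : ψ b = b := by rw [hψ, mul_div_cancel_left]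
    have hgs : ∀ x y, dd (g.symm x) (g.symm y) = dd x y := by
      intro x y
      rw [← hg]; simp
    have key := ih (((g.trans ψ).trans g.symm).trans ψ) ?_ ?_ ?_
    · simp only [Equiv.trans_apply] at key
      have e1 : dd b (ψ (g.symm (ψ (g b)))) = dd (ψ (g b)) (g b) := by
        calc dd b (ψ (g.symm (ψ (g b)))) = dd (ψ b) (ψ (g.symm (ψ (g b)))) := by rw [hψb]
          _ = dd (g.symm (ψ (g b))) b := hψd _ _
          _ = dd (g (g.symm (ψ (g b)))) (g b) := (hg _ _).symm
          _ = _ := by simp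
      rw [e1] at key
      have e2 : dd (ψ (g b)) (g b) ≥ 3 / 2 * dd b (g b) := by
        have hb := base g hg ga gc
        unfold dd at *
        set w : 𝔸 := ((b / g b : 𝔸ˣ) : 𝔸) - 1 with hw
        have : (ψ (g b) / g b : 𝔸ˣ) = (b / g b) * (b / g b) := by
          rw [hψ, div_mul_div_comm, div_div]
        rw [this, Units.val_mul]
        have h5 : ((b / g b : 𝔸ˣ) : 𝔸) * ((b / g b : 𝔸ˣ) : 𝔸) - 1 = (w + w) - (-(w * w)) := by
          rw [hw]; ring
        rw [h5]
        have h6 := norm_sub_norm_le (w + w) (-(w * w))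
        rw [norm_neg] at h6
        have h7 := norm_mul_le w w
        have h8 : ‖w + w‖ = 2 * ‖w‖ := by
          rw [← two_smul ℂ w, norm_smul]; simp
        nlinarith [norm_nonneg w]
      rw [pow_succ]
      nlinarith
    · intro x y
      simp only [Equiv.trans_apply]
      rw [hψd, hgs, hψd, hg]
    · simp only [Equiv.trans_apply]
      rw [ga, hψa]
      nth_rewrite 1 [← gc]
      rw [g.symm_apply_apply, hψc]
    · simp only [Equiv.trans_apply]
      rw [gc, hψc]
      nth_rewrite 1 [← ga]
      rw [g.symm_apply_apply, hψa]

theorem mu {𝔸 : Type*} [NormedCommRing 𝔸] [NormedAlgebra ℂ 𝔸]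
    {𝔹 : Type*} [NormedCommRing 𝔹] (T : 𝔸ˣ ≃ 𝔹ˣ) (hT : ∀ x y, dd (T x) (T y) = dd x y)
    (a b c : 𝔸ˣ) (habc : a * c = b * b)
    (h1 : dd a b ≤ 1 / 5) (h2 : dd b a ≤ 1 / 5) : T a * T c = T b * T b := by
  let ψ : Equiv.Perm 𝔸ˣ := Equiv.divLeft (b * b)
  let χ : Equiv.Perm 𝔹ˣ := Equiv.divLeft (T a * T c)
  have hψ : ∀ x, ψ x = b * b / x := fun x => rfl
  have hχ : ∀ x, χ x = T a * T c / x := fun x => rfl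
  have hψd : ∀ x y, dd (ψ x) (ψ y) = dd y x := by
    intro x y
    unfold dd
    rw [hψ, hψ, div_div_div_cancel_left]
  have hχd : ∀ x y, dd (χ x) (χ y) = dd y x := by
    intro x y
    unfold dd
    rw [hχ, hχ, div_div_div_cancel_left]
  have hTs : ∀ x y, dd (T.symm x) (T.symm y) = dd x y := by
    intro x y
    rw [← hT]; simp
  have hψa : ψ a = c := by rw [hψ, ← habc, mul_div_cancel_left]
  have hψc : ψ c = a := by rw [hψ, ← habc, mul_div_cancel_right]
  have hψb : ψ b = b := by rw [hψ, mul_div_cancel_left]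
  have hχa : χ (T a) = T c := by rw [hχ, mul_div_cancel_left]
  have hχc : χ (T c) = T a := by rw [hχ, mul_div_cancel_right]
  have key := fun n => mu_aux a b c habc h1 h2 n (((T.trans χ).trans T.symm).trans ψ)
    (by intro x y; simp only [Equiv.trans_apply]; rw [hψd, hTs, hχd, hT])
    (by simp only [Equiv.trans_apply]; rw [hχa, T.symm_apply_apply, hψc])
    (by simp only [Equiv.trans_apply]; rw [hχc, T.symm_apply_apply, hψa])
  simp only [Equiv.trans_apply] at key
  have lim : Filter.Tendsto (fun n : ℕ => (1 / 2 : ℝ) * (2 / 3) ^ n) Filter.atTop (nhds (1 / 2 * 0)) :=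
    (tendsto_pow_atTop_nhds_zero_of_lt_one (by norm_num) (by norm_num)).const_mul _
  have h0 : dd b (ψ (T.symm (χ (T b)))) ≤ 1 / 2 * 0 := ge_of_tendsto' lim key
  have h3 : b = ψ (T.symm (χ (T b))) := dd_eq_zero (le_antisymm (by simpa using h0) (norm_nonneg _))
  have h4 : ψ b = ψ (T.symm (χ (T b))) := by rw [hψb]; exact h3
  have h5 := ψ.injective h4
  have h6 : T b = χ (T b) := (T.symm_apply_eq.1 h5.symm).symm
  rw [hχ] at h6
  exact (eq_div_iff_mul_eq'.1 h6).symm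

set_option linter.unusedSectionVars false

section generic
variable {𝔸 : Type*} [NormedCommRing 𝔸] [NormedAlgebra ℂ 𝔸] [CompleteSpace 𝔸]
variable {𝔹 : Type*} [NormedCommRing 𝔹] [NormedAlgebra ℂ 𝔹] [CompleteSpace 𝔹]

theorem eU_small (𝔸 : Type*) [NormedCommRing 𝔸] [NormedAlgebra ℂ 𝔸] [CompleteSpace 𝔸]
    (ε : ℝ) (hε : 0 < ε) : ∃ r > 0, ∀ v : 𝔸, ‖v‖ < r → ‖(eU v : 𝔸) - 1‖ < ε := by
  have hc : ContinuousAt (NormedSpace.exp : 𝔸 → 𝔸) 0 :=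
    (hasStrictFDerivAt_exp_zero (𝕂 := ℂ) (𝔸 := 𝔸)).hasFDerivAt.continuousAt
  obtain ⟨r, hr, h⟩ := Metric.continuousAt_iff.1 hc ε hε
  refine ⟨r, hr, fun v hv => ?_⟩
  have := h (show dist v 0 < r by simpa using hv)
  rw [NormedSpace.exp_zero, dist_eq_norm] at this
  exact this

theorem dd_eU (f : 𝔸ˣ) (u v : 𝔸) : dd (f * eU u) (f * eU v) = ‖(eU (u - v) : 𝔸) - 1‖ := by
  unfold dd
  rw [mul_div_mul_left_eq_div, sub_eq_add_neg u v, eU_add, eU_neg, div_eq_mul_inv]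

theorem T_pow (T : 𝔸ˣ ≃ 𝔹ˣ) (T1 : T 1 = 1) (hT : ∀ x y, dd (T x) (T y) = dd x y) :
    ∃ r > 0, ∀ v : 𝔸, ‖v‖ < r → ∀ n : ℕ, T (eU (n • v)) = T (eU v) ^ n := by
  obtain ⟨r, hr, h⟩ := eU_small 𝔸 (1/5) (by norm_num)
  refine ⟨r, hr, fun v hv => ?_⟩
  have step : ∀ n : ℕ, T (eU (n • v)) * T (eU ((n + 2) • v)) =
      T (eU ((n + 1) • v)) * T (eU ((n + 1) • v)) := by
    intro n
    apply mu T hT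
    · rw [← eU_add, ← eU_add]; congr 1
      simp only [add_smul]; rw [two_smul, one_smul]; abel
    · have := dd_eU 1 (n • v) ((n+1) • v)
      rw [one_mul, one_mul] at this
      rw [this]; apply (h _ _).le
      rw [add_smul, one_smul]; simpa using hv
    · have := dd_eU 1 ((n + 1) • v) (n • v)
      rw [one_mul, one_mul] at this
      rw [this]; apply (h _ _).le
      rw [add_smul, one_smul]; simpa using hv
  have : ∀ n : ℕ, T (eU (n • v)) = T (eU v) ^ n ∧ T (eU ((n + 1) • v)) = T (eU v) ^ (n + 1) := by
    intro n
    induction n with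
    | zero => simp [eU_zero, T1]
    | succ n ih =>
      refine ⟨ih.2, ?_⟩
      have := step n
      rw [ih.1, ih.2] at this
      apply mul_left_cancel (a := T (eU v) ^ n)
      rw [this, ← pow_add, ← pow_add]
      congr 1; ring
  exact fun n => (this n).1

theorem T_add_loc (T : 𝔸ˣ ≃ 𝔹ˣ) (T1 : T 1 = 1) (hT : ∀ x y, dd (T x) (T y) = dd x y) :
    ∃ r > 0, ∀ u v : 𝔸, ‖u‖ < r → ‖v‖ < r → T (eU (u + v)) = T (eU u) * T (eU v) := by
  obtain ⟨r, hr, h⟩ := eU_small 𝔸 (1/5) (by norm_num)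
  refine ⟨r, hr, fun u v hu hv => ?_⟩
  set m : 𝔸 := (1 / 2 : ℂ) • (u + v) with hm
  have hmm : m + m = u + v := by
    rw [hm, ← add_smul]; norm_num
  have hmn : ‖m‖ < r := by
    rw [hm, norm_smul]
    have := norm_add_le u v
    norm_num
    linarith
  have h1 : T 1 * T (eU (u + v)) = T (eU m) * T (eU m) := by
    apply mu T hT
    · rw [one_mul, ← eU_add, hmm]
    · have := dd_eU 1 0 m
      rw [one_mul, one_mul, eU_zero] at this
      rw [this]; exact (h _ (by simpa using hmn)).le
    · have := dd_eU 1 m 0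
      rw [one_mul, one_mul, eU_zero] at this
      rw [this]; exact (h _ (by simpa using hmn)).le
  have hum : ‖u - m‖ < r := by
    have : u - m = (1 / 2 : ℂ) • (u - v) := by
      rw [hm]; module
    rw [this, norm_smul]
    have := norm_sub_le u v
    norm_num
    linarith
  have h2 : T (eU u) * T (eU v) = T (eU m) * T (eU m) := by
    apply mu T hT
    · rw [← eU_add, ← eU_add, hmm]
    · have := dd_eU 1 u m
      rw [one_mul, one_mul] at this
      rw [this]; exact (h _ hum).le
    · have := dd_eU 1 m u
      rw [one_mul, one_mul] at this
      rw [this]; exact (h _ (by rwa [norm_sub_rev])).le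
  rw [T1, one_mul] at h1
  rw [h1, h2]

theorem exists_nat_small (r : ℝ) (hr : 0 < r) (C : ℝ) :
    ∃ N : ℕ, 0 < N ∧ ∀ u : 𝔸, ‖u‖ ≤ C → ‖((N : ℂ)⁻¹) • u‖ < r := by
  obtain ⟨N, hN⟩ := exists_nat_gt (|C| / r)
  have hN0 : (0 : ℝ) < N := lt_of_le_of_lt (by positivity) hN
  refine ⟨N, by exact_mod_cast hN0, fun u hu => ?_⟩
  rw [norm_smul, norm_inv, Complex.norm_natCast, inv_mul_lt_iff₀ hN0]
  rw [div_lt_iff₀ hr] at hN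
  exact lt_of_le_of_lt (hu.trans (le_abs_self C)) hN

theorem nsmul_inv_smul (N : ℕ) (hN : 0 < N) (u : 𝔸) : N • ((N : ℂ)⁻¹ • u) = u := by
  rw [← Nat.cast_smul_eq_nsmul ℂ, smul_smul, mul_inv_cancel₀ (by exact_mod_cast hN.ne'), one_smul]

theorem T_add (T : 𝔸ˣ ≃ 𝔹ˣ) (T1 : T 1 = 1) (hT : ∀ x y, dd (T x) (T y) = dd x y) (u v : 𝔸) :
    T (eU (u + v)) = T (eU u) * T (eU v) := by
  obtain ⟨r, hr, h⟩ := T_pow T T1 hT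
  obtain ⟨r', hr', h'⟩ := T_add_loc T T1 hT
  obtain ⟨N, hN, hs⟩ := exists_nat_small (𝔸 := 𝔸) (min r r') (lt_min hr hr') (‖u‖ + ‖v‖)
  have key : ∀ w : 𝔸, ‖w‖ ≤ ‖u‖ + ‖v‖ → T (eU w) = T (eU ((N : ℂ)⁻¹ • w)) ^ N := by
    intro w hw
    rw [← h _ ((hs w hw).trans_le (min_le_left _ _)), nsmul_inv_smul N hN]
  rw [key _ (norm_add_le u v), key u (by simp), key v (by simp), smul_add,
    h' _ _ ((hs u (by simp)).trans_le (min_le_right _ _))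
      ((hs v (by simp)).trans_le (min_le_right _ _)), mul_pow]

theorem slope_lim (u : 𝔸) : Filter.Tendsto (fun n : ℕ => ((n : ℂ) + 1) • ((eU (((n : ℂ) + 1)⁻¹ • u) : 𝔸) - 1))
    Filter.atTop (nhds u) := by
  have h := (hasDerivAt_exp_smul_const (𝕂 := ℂ) u 0)
  rw [hasDerivAt_iff_tendsto_slope_zero] at h
  simp only [zero_smul, NormedSpace.exp_zero, one_mul, zero_add] at h
  have h2 : Filter.Tendsto (fun n : ℕ => ((n : ℂ) + 1)⁻¹) Filter.atTop (nhdsWithin 0 {0}ᶜ) := by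
    apply tendsto_nhdsWithin_of_tendsto_nhds_of_eventually_within
    · have := tendsto_one_div_add_atTop_nhds_zero_nat (𝕜 := ℂ)
      simpa using this
    · filter_upwards with n
      simp only [Set.mem_compl_iff, Set.mem_singleton_iff, inv_eq_zero]
      exact_mod_cast n.succ_ne_zero
  have := h.comp h2
  refine this.congr fun n => ?_
  simp [eU]

theorem T_nsmul (T : 𝔸ˣ ≃ 𝔹ˣ) (T1 : T 1 = 1) (hT : ∀ x y, dd (T x) (T y) = dd x y) (n : ℕ) (v : 𝔸) :
    T (eU (n • v)) = T (eU v) ^ n := by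
  induction n with
  | zero => simp [eU_zero, T1]
  | succ n ih => rw [succ_nsmul, T_add T T1 hT, ih, pow_succ]

theorem T_norm (T : 𝔸ˣ ≃ 𝔹ˣ) (T1 : T 1 = 1) (hT : ∀ x y, dd (T x) (T y) = dd x y) (v : 𝔸) :
    ‖(T (eU v) : 𝔹) - 1‖ = ‖(eU v : 𝔸) - 1‖ := by
  have := hT (eU v) 1
  simpa [dd, T1] using this

theorem gen_exists (T : 𝔸ˣ ≃ 𝔹ˣ) (T1 : T 1 = 1) (hT : ∀ x y, dd (T x) (T y) = dd x y) (u : 𝔸) :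
    ∃ w : 𝔹, ∀ n : ℕ, T (eU (((n : ℂ) + 1)⁻¹ • u)) = eU (((n : ℂ) + 1)⁻¹ • w) := by
  obtain ⟨r, hr, hinj, hlog⟩ := exp_loc 𝔹
  obtain ⟨δ, hδ, hlog⟩ := hlog (r / 3) (by positivity)
  obtain ⟨r1, hr1, hsm⟩ := eU_small 𝔸 δ hδ
  have : ∀ v : 𝔸, ∃ l : 𝔹, ‖v‖ < r1 → ‖l‖ < r / 3 ∧ eU l = T (eU v) := by
    intro v
    by_cases hv : ‖v‖ < r1
    · obtain ⟨l, hl, hl'⟩ := hlog (T (eU v)) (by rw [T_norm T T1 hT]; exact hsm v hv)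
      exact ⟨l, fun _ => ⟨hl, Units.ext hl'⟩⟩
    · exact ⟨0, fun h => absurd h hv⟩
  choose l hl using this
  obtain ⟨N, hN, hs⟩ := exists_nat_small (𝔸 := 𝔸) r1 hr1 ‖u‖
  refine ⟨N • l ((N : ℂ)⁻¹ • u), fun n => ?_⟩
  set m : ℕ := n + 1 with hm
  have hmc : ((n : ℂ) + 1) = (m : ℂ) := by rw [hm]; push_cast; ring
  have hm0 : 0 < m := Nat.succ_pos n
  rw [hmc]
  set x : 𝔸 := (m : ℂ)⁻¹ • ((N : ℂ)⁻¹ • u) with hx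
  have hmx : m • x = (N : ℂ)⁻¹ • u := nsmul_inv_smul m hm0 _
  have hkx : ∀ k : ℕ, k ≤ m → ‖k • x‖ < r1 := by
    intro k hk
    have h1 : ‖k • x‖ ≤ ‖m • x‖ := by
      rw [← Nat.cast_smul_eq_nsmul ℂ, ← Nat.cast_smul_eq_nsmul ℂ, norm_smul (k : ℂ) x, norm_smul (m : ℂ) x,
        Complex.norm_natCast, Complex.norm_natCast]
      gcongr
    rw [hmx] at h1
    exact h1.trans_lt (hs u le_rfl)
  have hx1 : ‖x‖ < r1 := by simpa using hkx 1 hm0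
  have claim : ∀ k : ℕ, k ≤ m → k • l x = l (k • x) := by
    intro k
    induction k with
    | zero =>
      intro _
      have h0 := hl 0 (by simpa using hr1)
      rw [eU_zero, T1] at h0
      have := hinj (l 0) (by linarith) h0.2
      simp [this]
    | succ k ih =>
      intro hk
      have hk' := ih (by omega)
      have h1 := hl _ (hkx (k + 1) hk)
      have h2 := hl _ (hkx k (by omega))
      have h3 := hl _ hx1
      have : (k + 1) • l x - l ((k + 1) • x) = 0 := by
        apply hinj
        · rw [succ_nsmul, hk']
          have e1 := norm_sub_le (l (k • x) + l x) (l ((k + 1) • x))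
          have e2 := norm_add_le (l (k • x)) (l x)
          linarith
        · rw [sub_eq_add_neg, eU_add, eU_neg, h1.2, eU_nsmul, h3.2, T_nsmul T T1 hT, mul_inv_cancel]
      exact sub_eq_zero.1 this
  have h1 := claim m le_rfl
  rw [hmx] at h1
  have h2 : (m : ℂ)⁻¹ • (N • l ((N : ℂ)⁻¹ • u)) = N • l x := by
    rw [← h1, smul_comm N m, smul_comm (m : ℂ)⁻¹ m, nsmul_inv_smul m hm0]
  rw [h2, eU_nsmul, (hl x hx1).2, ← T_nsmul T T1 hT]
  congr 2
  rw [hx, smul_comm (m : ℂ)⁻¹, nsmul_inv_smul N hN]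

theorem gen_unique (w w' : 𝔹) (h : ∀ n : ℕ, eU (((n : ℂ) + 1)⁻¹ • w) = eU (((n : ℂ) + 1)⁻¹ • w')) :
    w = w' := by
  refine tendsto_nhds_unique (slope_lim w) ((slope_lim w').congr fun n => ?_)
  rw [h]

theorem linearize (T : 𝔸ˣ ≃ 𝔹ˣ) (T1 : T 1 = 1) (hT : ∀ x y, dd (T x) (T y) = dd x y) :
    ∃ S : 𝔸 → 𝔹, (∀ u v, S (u + v) = S u + S v) ∧ (∀ (t : ℝ) u, S ((t : ℂ) • u) = (t : ℂ) • S u) ∧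
      (∀ u, ‖S u‖ = ‖u‖) ∧ Function.Surjective S ∧ ∀ u, T (eU u) = eU (S u) := by
  choose S hS using gen_exists T T1 hT
  have hadd : ∀ u v, S (u + v) = S u + S v := by
    intro u v
    apply gen_unique
    intro n
    rw [← hS, smul_add, smul_add, T_add T T1 hT, eU_add, hS, hS]
  have hnorm : ∀ u, ‖S u‖ = ‖u‖ := by
    intro u
    refine tendsto_nhds_unique (slope_lim (S u)).norm ((slope_lim u).norm.congr fun n => ?_)
    rw [norm_smul, norm_smul, ← hS, T_norm T T1 hT]
  have T1' : T.symm 1 = 1 := by rw [T.symm_apply_eq, T1]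
  have hT' : ∀ x y, dd (T.symm x) (T.symm y) = dd x y := fun x y => by rw [← hT]; simp
  refine ⟨S, hadd, ?_, hnorm, ?_, ?_⟩
  · let S' : 𝔸 →+ 𝔹 := AddMonoidHom.mk' S hadd
    have hc : Continuous S' := AddMonoidHomClass.continuous_of_bound S' 1 (fun u => by
      rw [one_mul]; exact (hnorm u).le)
    intro t u
    have := map_real_smul S' hc t u
    rw [Complex.coe_smul, Complex.coe_smul]
    exact this
  · intro w
    obtain ⟨u, hu⟩ := gen_exists T.symm T1' hT' w
    refine ⟨u, ?_⟩
    apply gen_unique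
    intro n
    rw [← hS, ← hu, T.apply_symm_apply]
  · intro u
    have := hS u 0
    simpa using this

end generic

section fa
variable {X : Type*} [TopologicalSpace X] [CompactSpace X]

/-- `E` is cut out by functions of norm at most one, equal to one on `E`. -/
def PE (A : Subalgebra ℂ C(X, ℂ)) (E : Set X) : Prop :=
  ∀ z, z ∉ E → ∃ g : A, (∀ w, ‖g.1 w‖ ≤ 1) ∧ (∀ w ∈ E, g.1 w = 1) ∧ ‖g.1 z‖ < 1

theorem half_lt {c : ℂ} (h : ‖c‖ ≤ 1) (h1 : c ≠ 1) : ‖(1 / 2 : ℂ) * (1 + c)‖ < 1 := by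
  have h2 : ‖1 + c‖ < 2 := by
    by_contra h3
    push Not at h3
    apply h1
    have h4 : c.re ^ 2 + c.im ^ 2 ≤ 1 := by
      have := Complex.sq_norm c
      rw [Complex.normSq_apply] at this
      nlinarith [norm_nonneg c]
    have h5 : 4 ≤ (1 + c.re) ^ 2 + c.im ^ 2 := by
      have := Complex.sq_norm (1 + c)
      rw [Complex.normSq_apply] at this
      simp only [Complex.add_re, Complex.one_re, Complex.add_im, Complex.one_im, zero_add] at this
      nlinarith
    have h6 : 1 ≤ c.re := by nlinarith
    have h7 : c.im = 0 := by nlinarith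
    have h8 : c.re = 1 := by nlinarith
    exact Complex.ext h8 h7
  rw [norm_mul]
  norm_num
  linarith

theorem half_le {c : ℂ} (h : ‖c‖ ≤ 1) : ‖(1 / 2 : ℂ) * (1 + c)‖ ≤ 1 := by
  rw [norm_mul]
  have := norm_add_le (1 : ℂ) c
  norm_num at *
  linarith

/-- The averaged function. -/
noncomputable def hf {A : Subalgebra ℂ C(X, ℂ)} (g : A) : A := (1 / 2 : ℂ) • (1 + g)

theorem hf_apply {A : Subalgebra ℂ C(X, ℂ)} (g : A) (z : X) :
    (hf g).1 z = (1 / 2 : ℂ) * (1 + g.1 z) := rfl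

theorem mem_choquet_of_PE {A : Subalgebra ℂ C(X, ℂ)} {x : X} (h : PE A {x}) : x ∈ ChoquetBdry A := by
  refine ⟨{E | IsPeakSet A E ∧ x ∈ E}, fun E hE => hE.1, ?_⟩
  apply Set.eq_singleton_iff_unique_mem.2
  refine ⟨fun E hE => hE.2, fun z hz => ?_⟩
  by_contra hne
  obtain ⟨g, hg1, hgx, hgz⟩ := h z hne
  have hgx := hgx x rfl
  have hle : ∀ w, ‖(hf g).1 w‖ ≤ 1 := fun w => by rw [hf_apply]; exact half_le (hg1 w)
  have hx1 : (hf g).1 x = 1 := by rw [hf_apply, hgx]; norm_num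
  have hn : ‖(hf g).1‖ = 1 := by
    apply le_antisymm
    · exact (ContinuousMap.norm_le _ zero_le_one).2 hle
    · have := (hf g).1.norm_coe_le_norm x
      rw [hx1] at this; simpa using this
  have hz' := hz ((hf g).1 ⁻¹' {1}) ⟨⟨(hf g).1, (hf g).2, ?_, rfl⟩, hx1⟩
  · have h1 : (hf g).1 z = 1 := hz'
    have : ‖(hf g).1 z‖ < 1 := by
      rw [hf_apply]
      apply half_lt (hg1 z)
      intro h2; rw [h2] at hgz; simp at hgz
    rw [h1] at this; simp at this
  · apply Set.eq_singleton_iff_unique_mem.2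
    refine ⟨⟨⟨x, hx1⟩, by rw [hn]; simp⟩, ?_⟩
    rintro _ ⟨⟨w, rfl⟩, hw⟩
    rw [hn] at hw
    have : g.1 w = 1 := by
      by_contra hne
      have := half_lt (hg1 w) hne
      rw [← hf_apply, hw] at this
      exact lt_irrefl _ this
    rw [hf_apply, this]; norm_num

theorem PE_of_mem_choquet {A : Subalgebra ℂ C(X, ℂ)} {x : X} (h : x ∈ ChoquetBdry A) : PE A {x} := by
  obtain ⟨P, hP, hPx⟩ := h
  intro z hz
  rw [← hPx] at hz
  simp only [Set.mem_sInter, not_forall] at hz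
  obtain ⟨E, hE, hzE⟩ := hz
  have hxE : x ∈ E := by
    have : x ∈ ⋂₀ P := by rw [hPx]; rfl
    exact this E hE
  obtain ⟨f, hf, hp, rfl⟩ := hP E hE
  have h1 : (1 : ℂ) ∈ perSpec f := by rw [hp]; rfl
  have hn : ‖f‖ = 1 := by rw [← h1.2]; simp
  have hle : ∀ w, ‖f w‖ ≤ 1 := fun w => by rw [← hn]; exact f.norm_coe_le_norm w
  refine ⟨⟨f, hf⟩, hle, ?_, ?_⟩
  · rintro w rfl; exact hxE
  · apply lt_of_le_of_ne (hle z)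
    intro h2
    have : f z ∈ perSpec f := ⟨⟨z, rfl⟩, by rw [hn]; exact h2⟩
    rw [hp] at this
    exact hzE this

theorem peaking {A : Subalgebra ℂ C(X, ℂ)} {E : Set X} (h : PE A E) (U : Set X) (hU : IsOpen U)
    (hEU : E ⊆ U) : ∃ g : A, (∀ w, ‖g.1 w‖ ≤ 1) ∧ (∀ w ∈ E, g.1 w = 1) ∧ ∀ z, z ∉ U → ‖g.1 z‖ ≤ 1 / 2 := by
  have hc : IsCompact Uᶜ := hU.isClosed_compl.isCompact
  refine hc.induction_on (p := fun s => ∃ g : A, (∀ w, ‖g.1 w‖ ≤ 1) ∧ (∀ w ∈ E, g.1 w = 1) ∧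
    ∀ z, z ∈ s → ‖g.1 z‖ ≤ 1 / 2) ?_ ?_ ?_ ?_
  · exact ⟨1, fun w => by simp, fun w _ => rfl, fun z hz => absurd hz (by simp)⟩
  · rintro s t hst ⟨g, h1, h2, h3⟩
    exact ⟨g, h1, h2, fun z hz => h3 z (hst hz)⟩
  · rintro s t ⟨g, h1, h2, h3⟩ ⟨g', h1', h2', h3'⟩
    refine ⟨g * g', ?_, ?_, ?_⟩
    · intro w
      change ‖g.1 w * g'.1 w‖ ≤ 1
      rw [norm_mul]; exact mul_le_one₀ (h1 w) (norm_nonneg _) (h1' w)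
    · intro w hw
      change g.1 w * g'.1 w = 1
      rw [h2 w hw, h2' w hw, one_mul]
    · intro z hz
      change ‖g.1 z * g'.1 z‖ ≤ 1 / 2
      rw [norm_mul]
      rcases hz with hz | hz
      · exact (mul_le_of_le_one_right (norm_nonneg _) (h1' z)).trans (h3 z hz)
      · exact (mul_le_of_le_one_left (norm_nonneg _) (h1 z)).trans (h3' z hz)
  · intro z hz
    obtain ⟨g, h1, h2, h3⟩ := h z (fun hz' => hz (hEU hz'))
    obtain ⟨c, hc1, hc2⟩ := exists_between h3
    have hc0 : 0 ≤ c := (norm_nonneg _).trans hc1.le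
    obtain ⟨n, hn⟩ := exists_pow_lt_of_lt_one (show (0 : ℝ) < 1 / 2 by norm_num) hc2
    refine ⟨{w | ‖g.1 w‖ < c}, ?_, g ^ n, ?_, ?_, ?_⟩
    · apply mem_nhdsWithin_of_mem_nhds
      exact (isOpen_lt (g.1.continuous.norm) continuous_const).mem_nhds hc1
    · intro w
      change ‖(g.1 w) ^ n‖ ≤ 1
      rw [norm_pow]; exact pow_le_one₀ (norm_nonneg _) (h1 w)
    · intro w hw
      change (g.1 w) ^ n = 1
      rw [h2 w hw, one_pow]
    · intro w hw
      change ‖(g.1 w) ^ n‖ ≤ 1 / 2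
      rw [norm_pow]
      exact (pow_le_pow_left₀ (norm_nonneg _) (le_of_lt hw) n).trans hn.le

theorem bishop {A : Subalgebra ℂ C(X, ℂ)} [CompleteSpace A] {E : Set X} (h : PE A E)
    (ρ : X → ℝ) (hρ : Continuous ρ) (hE : ∀ z ∈ E, ρ z ≤ 0) :
    ∃ q : A, ∃ a : ℝ, 0 ≤ a ∧ (∀ w, ‖q.1 w‖ ≤ 1) ∧ (∀ w ∈ E, q.1 w = 1) ∧
      ∀ z, ρ z ≤ a * (1 - (q.1 z).re) := by
  obtain ⟨M0, hM0⟩ := (isCompact_range hρ).bddAbove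
  set M := max M0 1 with hM
  have hMpos : 0 < M := lt_of_lt_of_le one_pos (le_max_right _ _)
  have hρM : ∀ z, ρ z ≤ M := fun z => (hM0 ⟨z, rfl⟩).trans (le_max_left _ _)
  have : ∀ m : ℕ, ∃ g : A, (∀ w, ‖g.1 w‖ ≤ 1) ∧ (∀ w ∈ E, g.1 w = 1) ∧
      ∀ z, z ∉ {z | ρ z < M * (1 / 2) ^ m} → ‖g.1 z‖ ≤ 1 / 2 := by
    intro m
    apply peaking h _ (isOpen_lt hρ continuous_const)
    intro z hz
    exact (hE z hz).trans_lt (by positivity)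
  choose g h1 h2 h3 using this
  have hgn : ∀ m, ‖g m‖ ≤ 1 := fun m => (ContinuousMap.norm_le _ zero_le_one).2 (h1 m)
  have hgeo : HasSum (fun m : ℕ => (1 / 2 : ℝ) * (1 / 2) ^ m) 1 := by
    have := (hasSum_geometric_of_lt_one (r := (1/2 : ℝ)) (by norm_num) (by norm_num)).mul_left (1/2 : ℝ)
    have e : (1 / 2 : ℝ) * (1 - 1 / 2)⁻¹ = 1 := by norm_num
    rwa [e] at this
  have hsum : Summable (fun m : ℕ => (((1 / 2 : ℝ) * (1 / 2) ^ m : ℝ) : ℂ) • g m) := by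
    refine Summable.of_norm_bounded hgeo.summable (fun m => ?_)
    rw [norm_smul, Complex.norm_real, Real.norm_of_nonneg (by positivity)]
    exact mul_le_of_le_one_right (by positivity) (hgn m)
  obtain ⟨q, hq⟩ := hsum
  have hqz : ∀ z, HasSum (fun m : ℕ => (((1 / 2 : ℝ) * (1 / 2) ^ m : ℝ) : ℂ) * (g m).1 z) (q.1 z) := by
    intro z
    let ev : A →+ ℂ := ⟨⟨fun u => u.1 z, rfl⟩, fun _ _ => rfl⟩
    have hev : Continuous ev := (continuous_eval_const z).comp continuous_subtype_val
    exact hq.map ev hev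
  have hre : ∀ z, HasSum (fun m : ℕ => (1 / 2 : ℝ) * (1 / 2) ^ m * (1 - ((g m).1 z).re)) (1 - (q.1 z).re) := by
    intro z
    have := hgeo.sub (Complex.hasSum_re (hqz z))
    have e : ∀ m : ℕ, (1 / 2 : ℝ) * (1 / 2) ^ m * (1 - ((g m).1 z).re) =
        1 / 2 * (1 / 2) ^ m - ((((1 / 2 : ℝ) * (1 / 2) ^ m : ℝ) : ℂ) * (g m).1 z).re := by
      intro m
      rw [Complex.re_ofReal_mul]; ring
    simp only [e]; exact this
  have hrele : ∀ m z, ((g m).1 z).re ≤ 1 := fun m z => (Complex.re_le_norm _).trans (h1 m z)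
  refine ⟨q, 8 * M, by positivity, ?_, ?_, ?_⟩
  · intro w
    have : ‖∑' m : ℕ, (((1 / 2 : ℝ) * (1 / 2) ^ m : ℝ) : ℂ) * (g m).1 w‖ ≤ 1 := by
      apply tsum_of_norm_bounded hgeo
      intro m
      rw [norm_mul, Complex.norm_real, Real.norm_of_nonneg (by positivity)]
      exact mul_le_of_le_one_right (by positivity) (h1 m w)
    rwa [(hqz w).tsum_eq] at this
  · intro w hw
    have e := hqz w
    simp only [h2 _ w hw, mul_one] at e
    have e2 := Complex.hasSum_ofReal.2 hgeo
    rw [Complex.ofReal_one] at e2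
    exact e.unique e2
  · intro z
    have hnn : ∀ m : ℕ, 0 ≤ (1 / 2 : ℝ) * (1 / 2) ^ m * (1 - ((g m).1 z).re) := fun m =>
      mul_nonneg (by positivity) (by linarith [hrele m z])
    rcases le_or_gt (ρ z) 0 with h0 | h0
    · refine h0.trans (mul_nonneg (by positivity) ?_)
      exact (hre z).nonneg hnn
    · have hex : ∃ m : ℕ, M * (1 / 2) ^ m ≤ ρ z := by
        obtain ⟨m, hm⟩ := exists_pow_lt_of_lt_one (show (0 : ℝ) < ρ z / M by positivity)
          (show (1 / 2 : ℝ) < 1 by norm_num)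
        refine ⟨m, ?_⟩
        rw [lt_div_iff₀ hMpos] at hm; linarith
      classical
      have hm := Nat.find_spec hex
      set m := Nat.find hex with hmdef
      have hub : ρ z ≤ 2 * M * (1 / 2) ^ m := by
        rcases Nat.eq_zero_or_pos m with h0 | hpos
        · rw [h0]; simp; linarith [hρM z]
        · have := Nat.find_min hex (show m - 1 < Nat.find hex by omega)
          obtain ⟨k, hk⟩ : ∃ k, m = k + 1 := ⟨m - 1, by omega⟩
          rw [hk] at this ⊢
          simp only [Nat.add_sub_cancel] at this
          rw [pow_succ]; linarith
      have h4 := h3 m z (by simpa using hm)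
      have h5 : (1 / 2 : ℝ) * (1 / 2) ^ m * (1 - ((g m).1 z).re) ≤ 1 - (q.1 z).re :=
        le_hasSum (hre z) m (fun k _ => hnn k)
      have h6 : ((g m).1 z).re ≤ 1 / 2 := (Complex.re_le_norm _).trans h4
      have h7 : (1 / 2 : ℝ) * (1 / 2) ^ m * (1 / 2) ≤ 1 - (q.1 z).re := by
        refine le_trans ?_ h5
        gcongr; linarith
      calc ρ z ≤ 2 * M * (1 / 2) ^ m := hub
        _ = 8 * M * ((1 / 2 : ℝ) * (1 / 2) ^ m * (1 / 2)) := by ring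
        _ ≤ _ := by gcongr

theorem eU_apply {A : Subalgebra ℂ C(X, ℂ)} [CompleteSpace A] (u : A) (x : X) :
    (eU u : A).1 x = Complex.exp (u.1 x) := by
  let _ : NormedAlgebra ℚ A := NormedAlgebra.restrictScalars ℚ ℂ A
  let ev : A →+* ℂ := (Pi.evalRingHom (fun _ : X => ℂ) x).comp
    ((ContinuousMap.coeFnRingHom : C(X, ℂ) →+* (X → ℂ)).comp A.val.toRingHom)
  have hev : Continuous ev := (continuous_eval_const x).comp continuous_subtype_val
  have := NormedSpace.map_exp ev hev u
  rw [Complex.exp_eq_exp_ℂ]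
  exact this

theorem norm_attained [Nonempty X] (f : C(X, ℂ)) : ∃ x, ‖f x‖ = ‖f‖ := by
  obtain ⟨x, -, hx⟩ := isCompact_univ.exists_isMaxOn (Set.univ_nonempty (α := X))
    (f.continuous.norm.continuousOn)
  refine ⟨x, le_antisymm (f.norm_coe_le_norm x) ?_⟩
  exact (ContinuousMap.norm_le _ (norm_nonneg _)).2 fun z => hx (Set.mem_univ z)

theorem kexp {A : Subalgebra ℂ C(X, ℂ)} [CompleteSpace A] (q : A) (a : ℝ) (z : X) :
    ‖(eU (((a : ℂ)) • (q - 1)) : A).1 z‖ = Real.exp (-(a * (1 - (q.1 z).re))) := by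
  rw [eU_apply, Complex.norm_exp]
  change Real.exp (((a : ℂ) * (q.1 z - 1)).re) = _
  rw [Complex.re_ofReal_mul, Complex.sub_re, Complex.one_re]
  congr 1; ring

theorem kexp_one {A : Subalgebra ℂ C(X, ℂ)} [CompleteSpace A] (q : A) (a : ℝ) (z : X) (h : q.1 z = 1) :
    (eU (((a : ℂ)) • (q - 1)) : A).1 z = 1 := by
  rw [eU_apply]
  change Complex.exp ((a : ℂ) * (q.1 z - 1)) = _
  rw [h]; simp

theorem boundary {A : Subalgebra ℂ C(X, ℂ)} [CompleteSpace A]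
    (hsep : ∀ x x' : X, x ≠ x' → ∃ f ∈ A, f x ≠ f x') (f : A)
    (hf0 : ∀ x ∈ ChoquetBdry A, f.1 x = 0) : f = 0 := by
  by_contra hne
  have hX : Nonempty X := by
    by_contra hX
    rw [not_nonempty_iff] at hX
    exact hne (Subtype.ext (ContinuousMap.ext fun x => hX.elim x))
  obtain ⟨x0, hx0⟩ := norm_attained f.1
  have hfx0 : f.1 x0 ≠ 0 := by
    rw [← norm_ne_zero_iff, hx0, norm_ne_zero_iff]
    intro h; exact hne (Subtype.ext h)
  let S : Set (Set X) := {E | IsClosed E ∧ E.Nonempty ∧ PE A E}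
  -- cutting lemma
  have cut : ∀ E ∈ S, ∀ F : A, ∀ x1 ∈ E, F.1 x1 = 1 → (∀ z ∈ E, ‖F.1 z‖ ≤ 1) → {z ∈ E | F.1 z = 1} ∈ S := by
    rintro E ⟨hEc, hEn, hEP⟩ F x1 hx1 hF1 hFle
    refine ⟨hEc.inter (isClosed_singleton.preimage F.1.continuous), ⟨x1, hx1, hF1⟩, ?_⟩
    intro z hz
    by_cases hzE : z ∈ E
    · have hFz : F.1 z ≠ 1 := fun h => hz ⟨hzE, h⟩
      obtain ⟨q, a, ha, hq1, hqE, hqρ⟩ := bishop hEP (fun z => ‖F.1 z‖ - 1)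
        (F.1.continuous.norm.sub continuous_const) (fun z hz => by linarith [hFle z hz])
      let G : A := F * (eU (((a : ℂ)) • (q - 1)) : A)
      have hG : ∀ w, G.1 w = F.1 w * (eU (((a : ℂ)) • (q - 1)) : A).1 w := fun w => rfl
      have hGE : ∀ w ∈ E, G.1 w = F.1 w := by
        intro w hw
        rw [hG, kexp_one _ _ _ (hqE w hw), mul_one]
      have hGle : ∀ w, ‖G.1 w‖ ≤ 1 := by
        intro w
        rw [hG, norm_mul, kexp]
        have h1 : ‖F.1 w‖ ≤ Real.exp (a * (1 - (q.1 w).re)) := by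
          have := Real.add_one_le_exp (a * (1 - (q.1 w).re))
          have := hqρ w
          linarith
        calc _ ≤ Real.exp (a * (1 - (q.1 w).re)) * Real.exp (-(a * (1 - (q.1 w).re))) := by gcongr
          _ = 1 := by rw [← Real.exp_add]; simp
      refine ⟨hf G, ?_, ?_, ?_⟩
      · intro w; rw [hf_apply]; exact half_le (hGle w)
      · rintro w ⟨hw, hw1⟩
        rw [hf_apply, hGE w hw, hw1]; norm_num
      · rw [hf_apply]
        exact half_lt (hGle z) (by rw [hGE z hzE]; exact hFz)
    · obtain ⟨g, h1, h2, h3⟩ := hEP z hzE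
      exact ⟨g, h1, fun w hw => h2 w hw.1, h3⟩
  have huniv : Set.univ ∈ S := ⟨isClosed_univ, Set.univ_nonempty, fun z hz => absurd (Set.mem_univ z) hz⟩
  have hE0 := cut _ huniv ((f.1 x0)⁻¹ • f) x0 (Set.mem_univ _)
    (by change (f.1 x0)⁻¹ * f.1 x0 = 1; exact inv_mul_cancel₀ hfx0)
    (by
      intro z _
      change ‖(f.1 x0)⁻¹ * f.1 z‖ ≤ 1
      rw [norm_mul, norm_inv, inv_mul_le_iff₀ (norm_pos_iff.2 hfx0), mul_one, hx0]
      exact f.1.norm_coe_le_norm z)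
  obtain ⟨E, hEsub, hEmin⟩ := zorn_superset_nonempty S (by
    intro c hc hchain hcn
    refine ⟨⋂₀ c, ⟨isClosed_sInter fun t ht => (hc ht).1, ?_, ?_⟩, fun s hs => Set.sInter_subset_of_mem hs⟩
    · have : Nonempty c := hcn.to_subtype
      rw [Set.sInter_eq_iInter]
      apply IsCompact.nonempty_iInter_of_directed_nonempty_isCompact_isClosed
      · intro s t
        rcases hchain.total s.2 t.2 with h | h
        · exact ⟨s, subset_rfl, h⟩
        · exact ⟨t, h, subset_rfl⟩
      · exact fun s => (hc s.2).2.1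
      · exact fun s => (hc s.2).1.isCompact
      · exact fun s => (hc s.2).1
    · intro z hz
      simp only [Set.mem_sInter, not_forall] at hz
      obtain ⟨t, ht, hzt⟩ := hz
      obtain ⟨g, h1, h2, h3⟩ := (hc ht).2.2 z hzt
      exact ⟨g, h1, fun w hw => h2 w (hw t ht), h3⟩) _ hE0
  have hES : E ∈ S := hEmin.prop
  have hconst : ∀ h : A, ∀ z ∈ E, ∀ w ∈ E, h.1 z = h.1 w := by
    intro h
    obtain ⟨x1, hx1, hmax⟩ := hES.1.isCompact.exists_isMaxOn hES.2.1 (h.1.continuous.norm.continuousOn)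
    by_cases h0 : h.1 x1 = 0
    · have : ∀ z ∈ E, h.1 z = 0 := by
        intro z hz
        have := hmax hz
        simp only [Set.mem_ofPred_eq, h0, norm_zero] at this
        exact norm_le_zero_iff.1 this
      intro z hz w hw
      rw [this z hz, this w hw]
    · have hc := cut _ hES ((h.1 x1)⁻¹ • h) x1 hx1
        (by change (h.1 x1)⁻¹ * h.1 x1 = 1; exact inv_mul_cancel₀ h0)
        (by
          intro z hz
          change ‖(h.1 x1)⁻¹ * h.1 z‖ ≤ 1
          rw [norm_mul, norm_inv, inv_mul_le_iff₀ (norm_pos_iff.2 h0), mul_one]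
          exact hmax hz)
      have hsub := hEmin.le_of_le hc (fun z hz => hz.1)
      have : ∀ z ∈ E, h.1 z = h.1 x1 := by
        intro z hz
        have h1 : (h.1 x1)⁻¹ * h.1 z = 1 := (hsub hz).2
        exact ((inv_mul_eq_one₀ h0).1 h1).symm
      intro z hz w hw
      rw [this z hz, this w hw]
  obtain ⟨x, hx⟩ := hES.2.1
  have hEx : E = {x} := by
    apply Set.eq_singleton_iff_unique_mem.2 ⟨hx, fun z hz => ?_⟩
    by_contra hzx
    obtain ⟨g, hg, hgne⟩ := hsep z x hzx
    exact hgne (hconst ⟨g, hg⟩ z hz x hx)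
  have hxC : x ∈ ChoquetBdry A := mem_choquet_of_PE (hEx ▸ hES.2.2)
  have h1 : (f.1 x0)⁻¹ * f.1 x = 1 := (hEsub hx).2
  rw [hf0 x hxC] at h1
  simp at h1

theorem bishop_point {A : Subalgebra ℂ C(X, ℂ)} [CompleteSpace A] {x : X} (hx : PE A {x}) (F : A)
    (hF : F.1 x ≠ 0) : ∃ k : A, (eU k : A).1 x = 1 ∧ (∀ z, ‖F.1 z * (eU k : A).1 z‖ ≤ ‖F.1 x‖) ∧
      ∀ z, ‖F.1 z * (eU k : A).1 z‖ = ‖F.1 x‖ → F.1 z * (eU k : A).1 z = F.1 x := by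
  have hpos : 0 < ‖F.1 x‖ := norm_pos_iff.2 hF
  obtain ⟨q, a, ha, hq1, hqx, hqρ⟩ := bishop hx (fun z => 2 * (‖F.1 z - F.1 x‖ / ‖F.1 x‖))
    (by fun_prop) (by rintro z rfl; simp)
  have hmain : ∀ z, ‖F.1 z * (eU (((a : ℂ)) • (q - 1)) : A).1 z‖ ≤
      ‖F.1 x‖ * Real.exp (-(‖F.1 z - F.1 x‖ / ‖F.1 x‖)) := by
    intro z
    set ρ := ‖F.1 z - F.1 x‖ / ‖F.1 x‖ with hρ
    rw [norm_mul, kexp]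
    have h1 : ‖F.1 z‖ ≤ ‖F.1 x‖ * Real.exp ρ := by
      have e1 : ‖F.1 z‖ ≤ ‖F.1 x‖ + ‖F.1 z - F.1 x‖ := norm_le_norm_add_norm_sub' _ _
      have e2 : ‖F.1 z - F.1 x‖ = ‖F.1 x‖ * ρ := by rw [hρ]; field_simp
      have e3 := Real.add_one_le_exp ρ
      nlinarith
    have h2 : Real.exp (-(a * (1 - (q.1 z).re))) ≤ Real.exp (-(2 * ρ)) :=
      Real.exp_le_exp.2 (by have := hqρ z; linarith)
    calc _ ≤ ‖F.1 x‖ * Real.exp ρ * Real.exp (-(2 * ρ)) := by gcongr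
      _ = ‖F.1 x‖ * Real.exp (-ρ) := by
        rw [mul_assoc, ← Real.exp_add]; congr 2; ring
  have hρ0 : ∀ z, 0 ≤ ‖F.1 z - F.1 x‖ / ‖F.1 x‖ := fun z => by positivity
  refine ⟨((a : ℂ)) • (q - 1), kexp_one _ _ _ (hqx x rfl), ?_, ?_⟩
  · intro z
    refine (hmain z).trans (mul_le_of_le_one_right hpos.le ?_)
    rw [Real.exp_le_one_iff]; linarith [hρ0 z]
  · intro z hz
    have h1 := hmain z
    rw [hz] at h1
    have h2 : 1 ≤ Real.exp (-(‖F.1 z - F.1 x‖ / ‖F.1 x‖)) := by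
      by_contra hlt
      push Not at hlt
      nlinarith
    rw [Real.one_le_exp_iff] at h2
    have h3 : ‖F.1 z - F.1 x‖ / ‖F.1 x‖ = 0 := le_antisymm (by linarith) (hρ0 z)
    have h4 : F.1 z = F.1 x := by
      rw [div_eq_zero_iff] at h3
      rcases h3 with h3 | h3
      · exact sub_eq_zero.1 (norm_eq_zero.1 h3)
      · exact absurd h3 hpos.ne'
    rw [norm_mul, kexp, h4] at hz
    have h5 : Real.exp (-(a * (1 - (q.1 z).re))) = 1 := by
      apply mul_left_cancel₀ hpos.ne'; rw [hz, mul_one]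
    rw [Real.exp_eq_one_iff] at h5
    have h6 : (eU (((a : ℂ)) • (q - 1)) : A).1 z = 1 := by
      rcases mul_eq_zero.1 (neg_eq_zero.1 h5) with h7 | h7
      · rw [h7]; simp [eU]
      · apply kexp_one
        have h8 : (q.1 z).re = 1 := by linarith
        have h9 := hq1 z
        have h10 := Complex.sq_norm (q.1 z)
        rw [Complex.normSq_apply, h8] at h10
        have h11 : (q.1 z).im = 0 := by
          have : (q.1 z).im * (q.1 z).im ≤ 0 := by nlinarith [norm_nonneg (q.1 z)]
          nlinarith
        exact Complex.ext h8 h11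
    rw [h6, h4, mul_one]

theorem rigid_aux {A : Subalgebra ℂ C(X, ℂ)} [CompleteSpace A] (f F : A) {x : X} (hx : PE A {x})
    (hf0 : f.1 x ≠ 0) (hF0 : F.1 x ≠ 0)
    (h : ∀ u : A, ‖F * (eU u : A) - 1‖ = ‖f * (eU u : A) - 1‖) :
    ‖f.1 x‖ ≤ ‖F.1 x‖ ∧ (‖f.1 x‖ = ‖F.1 x‖ → f.1 x = F.1 x) := by
  have hXne : Nonempty X := ⟨x⟩
  obtain ⟨k, hkx, hkle, hkeq⟩ := bishop_point hx F hF0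
  obtain ⟨c, hc⟩ : ∃ c : ℂ, Complex.exp c = -(f.1 x)⁻¹ :=
    ⟨Complex.log (-(f.1 x)⁻¹), Complex.exp_log (by simpa using hf0)⟩
  have hcn : ‖Complex.exp c‖ = ‖f.1 x‖⁻¹ := by rw [hc]; simp
  have hcA : ∀ z, (eU (c • (1 : A)) : A).1 z = Complex.exp c := by
    intro z; rw [eU_apply]; change Complex.exp (c * 1) = _; rw [mul_one]
  have hu := h (k + c • 1)
  rw [eU_add] at hu
  have h1 : 2 ≤ ‖f * ((eU k * eU (c • 1) : Aˣ) : A) - 1‖ := by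
    have e := (f * ((eU k * eU (c • 1) : Aˣ) : A) - 1).1.norm_coe_le_norm x
    have e2 : (f * ((eU k * eU (c • 1) : Aˣ) : A) - 1).1 x = -2 := by
      change f.1 x * ((eU k : A).1 x * (eU (c • (1 : A)) : A).1 x) - 1 = -2
      rw [hkx, hcA, hc]; field_simp; norm_num
    have e4 : ‖(-2 : ℂ)‖ = 2 := by norm_num
    rw [e2, e4] at e
    exact e
  rw [← hu] at h1
  obtain ⟨z, hz⟩ := norm_attained (F * ((eU k * eU (c • 1) : Aˣ) : A) - 1).1
  have e3 : (F * ((eU k * eU (c • 1) : Aˣ) : A) - 1).1 z = F.1 z * (eU k : A).1 z * Complex.exp c - 1 := by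
    change F.1 z * ((eU k : A).1 z * (eU (c • (1 : A)) : A).1 z) - 1 = _
    rw [hcA]; ring
  have h2 : 2 ≤ ‖F.1 z * (eU k : A).1 z * Complex.exp c - 1‖ := by
    rw [← e3, hz]; exact h1
  set w := F.1 z * (eU k : A).1 z with hw
  have hfpos : 0 < ‖f.1 x‖ := norm_pos_iff.2 hf0
  have h3 : 1 ≤ ‖w * Complex.exp c‖ := by
    have := norm_sub_le (w * Complex.exp c) 1
    rw [norm_one] at this
    linarith
  have h3' : ‖f.1 x‖ ≤ ‖w‖ := by
    rw [norm_mul, hcn, ← div_eq_mul_inv, le_div_iff₀ hfpos, one_mul] at h3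
    exact h3
  refine ⟨h3'.trans (hkle z), fun heq => ?_⟩
  have h4 : ‖w‖ = ‖F.1 x‖ := le_antisymm (hkle z) (heq ▸ h3')
  have h5 : w = F.1 x := hkeq z h4
  have h6 : ‖w * Complex.exp c‖ ≤ 1 := by
    rw [norm_mul, hcn, h4, heq, mul_inv_cancel₀ (norm_pos_iff.2 hF0).ne']
  have h7 : -(w * Complex.exp c) = 1 := by
    by_contra hne
    have := half_lt (c := -(w * Complex.exp c)) (by rwa [norm_neg]) hne
    rw [norm_mul, ← sub_eq_add_neg, norm_sub_rev] at this
    norm_num at this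
    linarith
  rw [h5, hc] at h7
  field_simp at h7
  exact h7.symm

theorem rigid {A : Subalgebra ℂ C(X, ℂ)} [CompleteSpace A]
    (hsep : ∀ x x' : X, x ≠ x' → ∃ f ∈ A, f x ≠ f x') (f F : A)
    (hf0 : ∀ x, f.1 x ≠ 0) (hF0 : ∀ x, F.1 x ≠ 0)
    (h : ∀ u : A, ‖F * (eU u : A) - 1‖ = ‖f * (eU u : A) - 1‖) : F = f := by
  rw [← sub_eq_zero]
  apply boundary hsep
  intro x hx
  have hx' := PE_of_mem_choquet hx
  obtain ⟨h1, h2⟩ := rigid_aux f F hx' (hf0 x) (hF0 x) h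
  obtain ⟨h3, h4⟩ := rigid_aux F f hx' (hF0 x) (hf0 x) (fun u => (h u).symm)
  change F.1 x - f.1 x = 0
  rw [h2 (le_antisymm h1 h3), sub_self]

theorem cle {c : ℂ} {r : ℝ} (h1 : ‖c‖ ≤ r) (h2 : r ≤ c.re) : c = r := by
  have h3 := Complex.re_le_norm c
  have h4 : c.re = r := by linarith
  have h10 := Complex.sq_norm c
  rw [Complex.normSq_apply] at h10
  have h5 : ‖c‖ = r := by linarith
  rw [h5, h4] at h10
  have : c.im * c.im = 0 := by nlinarith
  apply Complex.ext
  · simp [h4]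
  · simpa using this

theorem cle2 {c : ℂ} {r : ℝ} (h1 : ‖c‖ ≤ r) (h2 : 1 + r ≤ ‖1 + c‖) : c = r := by
  have h10 := Complex.sq_norm c
  have h11 := Complex.sq_norm (1 + c)
  rw [Complex.normSq_apply] at h10 h11
  simp only [Complex.add_re, Complex.one_re, Complex.add_im, Complex.one_im, zero_add] at h11
  have h0 := norm_nonneg c
  apply cle h1
  nlinarith

theorem lemL {Y : Type*} [TopologicalSpace Y] [CompactSpace Y]
    {A : Subalgebra ℂ C(X, ℂ)} {B : Subalgebra ℂ C(Y, ℂ)}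
    (hsep : ∀ x x' : X, x ≠ x' → ∃ f ∈ A, f x ≠ f x') (R : A → B)
    (hadd : ∀ u v, R (u + v) = R u + R v) (hsm : ∀ (t : ℝ) u, R ((t : ℂ) • u) = (t : ℂ) • R u)
    (hn : ∀ u, ‖R u‖ = ‖u‖) (hR1 : R 1 = 1) (hs : Function.Surjective R) {y : Y} (hy : PE B {y}) :
    ∃ x, PE A {x} ∧ ∀ u : A, (u.1 x).re = ((R u).1 y).re := by
  have nle : ∀ (v : B) z, ‖v.1 z‖ ≤ ‖v‖ := fun v z => v.1.norm_coe_le_norm z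
  have nleA : ∀ (v : A) z, ‖v.1 z‖ ≤ ‖v‖ := fun v z => v.1.norm_coe_le_norm z
  have hXne : Nonempty X := by
    by_contra hX
    rw [not_nonempty_iff] at hX
    have e : (1 : A) = 0 := Subtype.ext (ContinuousMap.ext fun x => hX.elim x)
    have e1 := nle 1 y
    rw [← hR1, hn, e, norm_zero, ← e, hR1] at e1
    have e2 : ((1 : B).1 y) = 1 := rfl
    rw [e2, norm_one] at e1
    linarith
  let Fy : Type _ := {k : A // (R k).1 y = (‖k‖ : ℂ)}
  let E : Fy → Set X := fun k => {x | k.1.1 x = (‖k.1‖ : ℂ)}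
  have hR0 : R 0 = 0 := by
    have := hadd 0 0
    rw [add_zero] at this
    exact left_eq_add.1 this
  have hFne : Nonempty Fy := ⟨⟨0, by rw [hR0, norm_zero]; simp⟩⟩
  have hEc : ∀ k, IsClosed (E k) := fun k => isClosed_eq k.1.1.continuous continuous_const
  obtain ⟨x, hx⟩ : (⋂ k, E k).Nonempty := by
    apply IsCompact.nonempty_iInter_of_directed_nonempty_isCompact_isClosed
    · rintro ⟨k1, hk1⟩ ⟨k2, hk2⟩
      have hsum : ‖k1 + k2‖ = ‖k1‖ + ‖k2‖ := by
        apply le_antisymm (norm_add_le _ _)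
        have e := nle (R (k1 + k2)) y
        rw [hn, hadd] at e
        change ‖(R k1).1 y + (R k2).1 y‖ ≤ _ at e
        rw [hk1, hk2, ← Complex.ofReal_add, Complex.norm_real] at e
        exact (le_abs_self _).trans e
      refine ⟨⟨k1 + k2, ?_⟩, ?_, ?_⟩
      · rw [hsum, hadd]
        change (R k1).1 y + (R k2).1 y = _
        rw [hk1, hk2, Complex.ofReal_add]
      all_goals
        intro z hz
        change (k1 + k2).1 z = (‖k1 + k2‖ : ℂ) at hz
        rw [hsum] at hz
        have hz2 : (k1.1 z).re + (k2.1 z).re = ‖k1‖ + ‖k2‖ := by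
          have := congrArg Complex.re hz
          rw [Complex.ofReal_re] at this
          exact this
        have a1 := (Complex.re_le_norm _).trans (nleA k1 z)
        have a2 := (Complex.re_le_norm _).trans (nleA k2 z)
        exact cle (nleA _ z) (by linarith)
    · rintro ⟨k, hk⟩
      obtain ⟨z, hz⟩ := norm_attained (1 + k).1
      refine ⟨z, cle2 (nleA k z) ?_⟩
      change ‖1 + k.1 z‖ = ‖1 + k‖ at hz
      rw [hz, ← hn (1 + k), hadd, hR1]
      have e := nle (1 + R k) y
      change ‖1 + (R k).1 y‖ ≤ _ at e
      rw [hk] at e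
      refine le_trans ?_ e
      rw [← Complex.ofReal_one, ← Complex.ofReal_add, Complex.norm_real]
      exact le_abs_self _
    · exact fun k => (hEc k).isCompact
    · exact hEc
  have key : ∀ x', (∀ k : A, (R k).1 y = (‖k‖ : ℂ) → k.1 x' = (‖k‖ : ℂ)) →
      ∀ u : A, (u.1 x').re = ((R u).1 y).re := by
    intro x hx
    have k1 : ∀ u : A, (u.1 x).re ≤ ‖(R u).1 y‖ := by
      intro u
      apply le_of_forall_pos_le_add
      intro ε hε
      set v := R u with hv
      obtain ⟨p, hp1, hp2, hp3⟩ := peaking hy {z | ‖v.1 z‖ < ‖v.1 y‖ + ε}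
        (isOpen_lt v.1.continuous.norm continuous_const) (by rintro z rfl; exact lt_add_of_pos_right _ hε)
      have hpy : p.1 y = 1 := hp2 y rfl
      have hpn : ‖p‖ = 1 := by
        apply le_antisymm
        · exact (ContinuousMap.norm_le _ zero_le_one).2 hp1
        · have := nle p y; rwa [hpy, norm_one] at this
      set N : ℝ := 2 * ‖v‖ with hN
      have hN0 : 0 ≤ N := by positivity
      obtain ⟨k, hk⟩ := hs ((N : ℂ) • p)
      have hkn : ‖k‖ = N := by
        rw [← hn, hk, norm_smul, hpn, mul_one, Complex.norm_real, Real.norm_of_nonneg hN0]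
      have hkx : k.1 x = (N : ℂ) := by
        rw [← hkn]
        apply hx
        rw [hk, hkn]
        change (N : ℂ) * p.1 y = N
        rw [hpy, mul_one]
      have h1 : ‖u.1 x + N‖ ≤ ‖v + (N : ℂ) • p‖ := by
        rw [← hk, hv, ← hadd, hn, ← hkx]
        exact nleA (u + k) x
      have h2 : ‖v + (N : ℂ) • p‖ ≤ ‖v.1 y‖ + ε + N := by
        refine (ContinuousMap.norm_le _ (by positivity)).2 fun z => ?_
        change ‖v.1 z + (N : ℂ) * p.1 z‖ ≤ _
        have e1 := norm_add_le (v.1 z) ((N : ℂ) * p.1 z)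
        rw [norm_mul, Complex.norm_real, Real.norm_of_nonneg hN0] at e1
        by_cases hz : z ∈ {z | ‖v.1 z‖ < ‖v.1 y‖ + ε}
        · have e2 : ‖v.1 z‖ < ‖v.1 y‖ + ε := hz
          have e3 : N * ‖p.1 z‖ ≤ N := mul_le_of_le_one_right hN0 (hp1 z)
          linarith
        · have e2 := hp3 z hz
          have e3 : N * ‖p.1 z‖ ≤ N * (1 / 2) := mul_le_mul_of_nonneg_left e2 hN0
          have e4 := nle v z
          have := norm_nonneg (v.1 y)
          linarith
      have h3 := Complex.re_le_norm (u.1 x + N)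
      rw [Complex.add_re, Complex.ofReal_re] at h3
      linarith
    have k2 : ∀ u : A, (u.1 x).re ≤ ((R u).1 y).re := by
      intro u
      by_contra hlt
      push Not at hlt
      have hM : ∀ M : ℝ, (u.1 x).re + M ≤ ‖(R u).1 y + M‖ := by
        intro M
        have e := k1 (u + (M : ℂ) • 1)
        rw [hadd, hsm, hR1] at e
        change (u.1 x + (M : ℂ) * 1).re ≤ ‖(R u).1 y + (M : ℂ) * 1‖ at e
        rw [mul_one, Complex.add_re, Complex.ofReal_re] at e
        exact e
      set a := ((R u).1 y).re with ha
      set b := ((R u).1 y).im with hb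
      set d := (u.1 x).re - a with hd
      have hd0 : 0 < d := by linarith
      have e1 := hM (|a| + b ^ 2 / d)
      have e2 := Complex.sq_norm ((R u).1 y + ((|a| + b ^ 2 / d : ℝ) : ℂ))
      rw [Complex.normSq_apply, Complex.add_re, Complex.add_im, Complex.ofReal_re, Complex.ofReal_im,
        ← ha, ← hb] at e2
      have e3 : d * (b ^ 2 / d) = b ^ 2 := by field_simp
      set q := b ^ 2 / d with hq
      have hq0 : 0 ≤ q := by positivity
      have e4 : (u.1 x).re = a + d := by linarith
      rw [e4] at e1
      have ha0 := neg_abs_le a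
      have e5 : 0 ≤ a + d + (|a| + q) := by linarith
      have e6 := mul_self_le_mul_self e5 e1
      have e7 : 0 ≤ d * (a + |a|) := mul_nonneg hd0.le (by linarith)
      nlinarith [sq_nonneg b, mul_pos hd0 hd0]
    intro u
    apply le_antisymm (k2 u)
    have e := k2 (((-1 : ℝ) : ℂ) • u)
    rw [hsm] at e
    change (((-1 : ℝ) : ℂ) * u.1 x).re ≤ (((-1 : ℝ) : ℂ) * (R u).1 y).re at e
    rw [Complex.re_ofReal_mul, Complex.re_ofReal_mul] at e
    linarith
  rw [Set.mem_iInter] at hx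
  have hxk := key x (fun k hk => hx ⟨k, hk⟩)
  refine ⟨x, ?_, hxk⟩
  intro z hz
  obtain ⟨k, hk, hkz⟩ : ∃ k : A, (R k).1 y = (‖k‖ : ℂ) ∧ k.1 z ≠ (‖k‖ : ℂ) := by
    by_contra hcon
    push Not at hcon
    have hzk := key z hcon
    obtain ⟨f, hf, hfne⟩ := hsep z x hz
    apply hfne
    let u : A := ⟨f, hf⟩
    have e1 : (u.1 z).re = (u.1 x).re := by rw [hzk, hxk]
    have e2 : ((Complex.I • u).1 z).re = ((Complex.I • u).1 x).re := by rw [hzk, hxk]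
    change (Complex.I * u.1 z).re = (Complex.I * u.1 x).re at e2
    rw [Complex.I_mul_re, Complex.I_mul_re, neg_inj] at e2
    exact Complex.ext e1 e2
  have hk0 : ‖k‖ ≠ 0 := by
    intro h0
    apply hkz
    have := nleA k z
    rw [h0] at this ⊢
    rw [norm_le_zero_iff.1 this]; simp
  have hkpos : 0 < ‖k‖ := lt_of_le_of_ne (norm_nonneg _) hk0.symm
  have hg : ∀ w, (((‖k‖ : ℂ)⁻¹ • k).1 w) = (‖k‖ : ℂ)⁻¹ * k.1 w := fun w => rfl
  have hgle : ∀ w, ‖((‖k‖ : ℂ)⁻¹ • k).1 w‖ ≤ 1 := by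
    intro w
    rw [hg, norm_mul, norm_inv, Complex.norm_real, Real.norm_of_nonneg hkpos.le,
      inv_mul_le_iff₀ hkpos, mul_one]
    exact nleA k w
  have hkC : (‖k‖ : ℂ) ≠ 0 := by exact_mod_cast hk0
  refine ⟨hf ((‖k‖ : ℂ)⁻¹ • k), ?_, ?_, ?_⟩
  · intro w; rw [hf_apply]; exact half_le (hgle w)
  · rintro w rfl
    rw [hf_apply, hg, hx ⟨k, hk⟩, inv_mul_cancel₀ hkC]; norm_num
  · rw [hf_apply]
    apply half_lt (hgle z)
    rw [hg]
    intro hcon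
    exact hkz ((inv_mul_eq_one₀ hkC).1 hcon).symm

theorem perturb {c0 c : ℂ} (h0 : ‖c0‖ = 1) (h1 : ‖c0 + c‖ ≤ 1) (h2 : ‖c0 - c‖ ≤ 1) : c = 0 := by
  have e := parallelogram_law_with_norm ℝ c0 c
  rw [h0] at e
  have e1 := norm_nonneg (c0 + c)
  have e2 := norm_nonneg (c0 - c)
  have : ‖c‖ * ‖c‖ ≤ 0 := by nlinarith
  have h3 : ‖c‖ = 0 := mul_self_eq_zero.1 (le_antisymm this (mul_self_nonneg _))
  exact norm_eq_zero.1 h3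

theorem scal {w : ℂ} (h : ∀ t : ℝ, ‖Complex.exp ((t : ℂ) * w) - 1‖ ≤ |Real.exp t - 1|) :
    w.im = 0 ∧ 0 ≤ w.re ∧ w.re ≤ 1 := by
  have hpos : ∀ s : ℝ, 0 < s → ‖Complex.exp (((-s : ℝ) : ℂ) * w) - 1‖ < 1 := by
    intro s hs
    refine (h (-s)).trans_lt ?_
    have := Real.exp_pos (-s)
    rw [abs_lt]
    constructor
    · linarith
    · have : Real.exp (-s) < 1 := by
        rw [← Real.exp_zero]; exact Real.exp_lt_exp.2 (by linarith)
      linarith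
  have him : w.im = 0 := by
    by_contra hb
    have hb' : 0 < |w.im| := abs_pos.2 hb
    have e := hpos (Real.pi / |w.im|) (div_pos Real.pi_pos hb')
    have e1 := (Complex.abs_re_le_norm _).trans_lt e
    rw [Complex.sub_re, Complex.one_re, Complex.exp_re, Complex.im_ofReal_mul] at e1
    have e2 : Real.cos (-(Real.pi / |w.im|) * w.im) = -1 := by
      rcases abs_choice w.im with h1 | h1
      · rw [h1]
        have : -(Real.pi / w.im) * w.im = -Real.pi := by field_simp
        rw [this, Real.cos_neg, Real.cos_pi]
      · rw [h1]
        have : -(Real.pi / -w.im) * w.im = Real.pi := by field_simp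
        rw [this, Real.cos_pi]
    rw [e2, abs_lt] at e1
    have := Real.exp_pos ((((-(Real.pi / |w.im|) : ℝ) : ℂ) * w).re)
    linarith [e1.1]
  have hw : w = (w.re : ℂ) := Complex.ext (by simp) (by simp [him])
  have hre : ∀ t : ℝ, |Real.exp (t * w.re) - 1| ≤ |Real.exp t - 1| := by
    intro t
    have e := h t
    rw [hw] at e
    rw [← Complex.ofReal_mul, ← Complex.ofReal_exp, ← Complex.ofReal_one, ← Complex.ofReal_sub,
      Complex.norm_real] at e
    exact e
  refine ⟨him, ?_, ?_⟩
  · by_contra hlt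
    push Not at hlt
    have e := hre (1 / w.re)
    have e1 : 1 / w.re * w.re = 1 := div_mul_cancel₀ _ hlt.ne
    rw [e1] at e
    have e2 : 1 / w.re < 0 := div_neg_of_pos_of_neg one_pos hlt
    have e3 := Real.exp_lt_exp.2 e2
    rw [Real.exp_zero] at e3
    have e4 := Real.exp_pos (1 / w.re)
    have e5 := Real.add_one_lt_exp (one_ne_zero)
    have e6 : |Real.exp (1 / w.re) - 1| < 1 := by rw [abs_lt]; constructor <;> linarith
    have e7 := le_abs_self (Real.exp 1 - 1)
    linarith
  · have e := hre 1
    rw [one_mul] at e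
    have e5 : (1 : ℝ) < Real.exp 1 := Real.one_lt_exp_iff.2 one_pos
    rw [abs_of_pos (by linarith : 0 < Real.exp 1 - 1)] at e
    have := (le_abs_self _).trans e
    exact Real.exp_le_exp.1 (by linarith)

theorem structS {Y : Type*} [TopologicalSpace Y] [CompactSpace Y]
    {A : Subalgebra ℂ C(X, ℂ)} {B : Subalgebra ℂ C(Y, ℂ)} [CompleteSpace A] [CompleteSpace B]
    (S : A → B)
    (hadd : ∀ u v, S (u + v) = S u + S v) (hsm : ∀ (t : ℝ) u, S ((t : ℂ) • u) = (t : ℂ) • S u)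
    (hn : ∀ u, ‖S u‖ = ‖u‖) (hs : Function.Surjective S)
    (hexp : ∀ u, ‖(eU (S u) : B) - 1‖ = ‖(eU u : A) - 1‖) :
    S 1 = 1 ∧ S (Complex.I • 1) * S (Complex.I • 1) = -1 := by
  have nle : ∀ (v : B) z, ‖v.1 z‖ ≤ ‖v‖ := fun v z => v.1.norm_coe_le_norm z
  have nleA : ∀ (v : A) z, ‖v.1 z‖ ≤ ‖v‖ := fun v z => v.1.norm_coe_le_norm z
  have hS0 : S 0 = 0 := by
    have := hadd 0 0
    rw [add_zero] at this
    exact left_eq_add.1 this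
  have hsub : ∀ u v, S (u - v) = S u - S v := by
    intro u v
    have := hadd (u - v) v
    rw [sub_add_cancel] at this
    rw [this, add_sub_cancel_right]
  have pert : ∀ (c : ℂ) (q : B), ‖c‖ = 1 → (∀ z, ‖(S (c • 1)).1 z + q.1 z‖ ≤ 1) →
      (∀ z, ‖(S (c • 1)).1 z - q.1 z‖ ≤ 1) → q = 0 := by
    intro c q hc h1 h2
    obtain ⟨v, rfl⟩ := hs q
    have e1 : ‖c • 1 + v‖ ≤ 1 := by
      rw [← hn, hadd]; exact (ContinuousMap.norm_le _ zero_le_one).2 h1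
    have e2 : ‖c • 1 - v‖ ≤ 1 := by
      rw [← hn, hsub]; exact (ContinuousMap.norm_le _ zero_le_one).2 h2
    have hv : v = 0 := by
      apply Subtype.ext
      apply ContinuousMap.ext
      intro x
      apply perturb hc
      · have := (nleA _ x).trans e1
        change ‖c * 1 + v.1 x‖ ≤ 1 at this
        rwa [mul_one] at this
      · have := (nleA _ x).trans e2
        change ‖c * 1 - v.1 x‖ ≤ 1 at this
        rwa [mul_one] at this
    rw [hv, hS0]
  have scalA : ∀ c : ℂ, ‖(eU (c • (1 : A)) : A) - 1‖ ≤ ‖Complex.exp c - 1‖ := by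
    intro c
    refine (ContinuousMap.norm_le _ (norm_nonneg _)).2 fun z => ?_
    change ‖(eU (c • (1 : A)) : A).1 z - 1‖ ≤ _
    rw [eU_apply]
    change ‖Complex.exp (c * 1) - 1‖ ≤ _
    rw [mul_one]
  have expB : ∀ (u : A) z, ‖Complex.exp ((S u).1 z) - 1‖ ≤ ‖(eU u : A) - 1‖ := by
    intro u z
    rw [← hexp, ← eU_apply]
    exact nle ((eU (S u) : B) - 1) z
  have h1 : S 1 = 1 := by
    have hw : ∀ z, ((S 1).1 z).im = 0 ∧ 0 ≤ ((S 1).1 z).re ∧ ((S 1).1 z).re ≤ 1 := by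
      intro z
      apply scal
      intro t
      have e := expB ((t : ℂ) • 1) z
      rw [hsm] at e
      refine (e.trans (scalA _)).trans ?_
      rw [← Complex.ofReal_exp, ← Complex.ofReal_one, ← Complex.ofReal_sub, Complex.norm_real]
      rfl
    have := pert 1 (1 - S 1) norm_one (by
      intro z
      rw [one_smul]
      change ‖(S 1).1 z + (1 - (S 1).1 z)‖ ≤ 1
      rw [add_sub_cancel, norm_one]) (by
      intro z
      rw [one_smul]
      change ‖(S 1).1 z - (1 - (S 1).1 z)‖ ≤ 1
      obtain ⟨a1, a2, a3⟩ := hw z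
      have e : (S 1).1 z - (1 - (S 1).1 z) = ((2 * ((S 1).1 z).re - 1 : ℝ) : ℂ) := by
        apply Complex.ext
        · rw [Complex.ofReal_re]; simp; ring
        · rw [Complex.ofReal_im]; simp [a1]
      rw [e, Complex.norm_real, Real.norm_eq_abs, abs_le]
      constructor <;> linarith)
    exact (sub_eq_zero.1 this).symm
  refine ⟨h1, ?_⟩
  set j := S (Complex.I • 1) with hj
  have hjz : ∀ z, j.1 z = 0 ∨ j.1 z * j.1 z = -1 := by
    intro z
    have e := expB (((2 * Real.pi : ℝ) : ℂ) • Complex.I • 1) z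
    rw [hsm, smul_smul] at e
    have e2 := e.trans (scalA _)
    have e3 : Complex.exp (((2 * Real.pi : ℝ) : ℂ) * Complex.I) = 1 := by
      push_cast; exact Complex.exp_two_pi_mul_I
    rw [e3, sub_self, norm_zero] at e2
    have e4 := sub_eq_zero.1 (norm_le_zero_iff.1 e2)
    change Complex.exp (((2 * Real.pi : ℝ) : ℂ) * j.1 z) = 1 at e4
    obtain ⟨n, hn'⟩ := Complex.exp_eq_one_iff.1 e4
    have e5 : j.1 z = n * Complex.I := by
      have hp : (Real.pi : ℂ) ≠ 0 := by exact_mod_cast Real.pi_ne_zero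
      push_cast at hn'
      have : (2 * (Real.pi : ℂ)) * j.1 z = (2 * Real.pi) * (n * Complex.I) := by rw [hn']; ring
      exact mul_left_cancel₀ (mul_ne_zero two_ne_zero hp) this
    have e6 : ‖j.1 z‖ ≤ 1 := by
      refine (nle j z).trans ?_
      rw [hj, hn]
      refine (ContinuousMap.norm_le _ zero_le_one).2 fun x => ?_
      change ‖Complex.I * 1‖ ≤ 1
      rw [mul_one, Complex.norm_I]
    rw [e5, norm_mul, Complex.norm_I, mul_one, Complex.norm_intCast] at e6
    have e7 : |n| ≤ 1 := by exact_mod_cast e6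
    obtain ⟨e8, e9⟩ := abs_le.1 e7
    rw [e5]
    interval_cases n
    · right; push_cast; linear_combination Complex.I_mul_I
    · left; simp
    · right; push_cast; linear_combination Complex.I_mul_I
  have hn1 : ∀ z, j.1 z * j.1 z = -1 → ‖j.1 z‖ = 1 := by
    intro z hz
    have := congrArg norm hz
    rw [norm_mul, norm_neg, norm_one] at this
    nlinarith [norm_nonneg (j.1 z)]
  have := pert Complex.I (1 + j * j) Complex.norm_I (by
    intro z
    change ‖j.1 z + (1 + j.1 z * j.1 z)‖ ≤ 1
    rcases hjz z with h | h
    · rw [h]; simp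
    · rw [h, add_neg_cancel, add_zero, hn1 z h]) (by
    intro z
    change ‖j.1 z - (1 + j.1 z * j.1 z)‖ ≤ 1
    rcases hjz z with h | h
    · rw [h]; simp
    · rw [h, add_neg_cancel, sub_zero, hn1 z h])
  exact (neg_eq_of_add_eq_zero_right this).symm

theorem repc {Y : Type*} [TopologicalSpace Y] [CompactSpace Y]
    {A : Subalgebra ℂ C(X, ℂ)} {B : Subalgebra ℂ C(Y, ℂ)}
    (hsep : ∀ x x' : X, x ≠ x' → ∃ f ∈ A, f x ≠ f x') (S : A → B)
    (hadd : ∀ u v, S (u + v) = S u + S v) (hsm : ∀ (t : ℝ) u, S ((t : ℂ) • u) = (t : ℂ) • S u)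
    (hn : ∀ u, ‖S u‖ = ‖u‖) (hs : Function.Surjective S) (c d : ℂ) (m : B) (hc : ‖c‖ = 1) (hcd : c * d = 1)
    (hm : ∀ z, ‖m.1 z‖ = 1) (hmc : m * S (c • 1) = 1) {y : Y} (hy : PE B {y}) :
    ∃ x, PE A {x} ∧ ∀ u : A, (d * u.1 x).re = (m.1 y * (S u).1 y).re := by
  have hmn : ∀ v : B, ‖m * v‖ = ‖v‖ := by
    intro v
    apply le_antisymm
    · refine (ContinuousMap.norm_le _ (norm_nonneg _)).2 fun z => ?_
      change ‖m.1 z * v.1 z‖ ≤ _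
      rw [norm_mul, hm, one_mul]
      exact v.1.norm_coe_le_norm z
    · refine (ContinuousMap.norm_le _ (norm_nonneg _)).2 fun z => ?_
      have := (m * v).1.norm_coe_le_norm z
      change ‖m.1 z * v.1 z‖ ≤ _ at this
      rw [norm_mul, hm, one_mul] at this
      exact this
  obtain ⟨x, hx, hxu⟩ := lemL hsep (fun u => m * S (c • u))
    (by intro u v; change m * S (c • (u + v)) = m * S (c • u) + m * S (c • v); rw [smul_add, hadd, mul_add])
    (by
      intro t u
      change m * S (c • (t : ℂ) • u) = (t : ℂ) • (m * S (c • u))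
      rw [smul_comm, hsm, mul_smul_comm])
    (by
      intro u
      change ‖m * S (c • u)‖ = ‖u‖
      rw [hmn, hn, norm_smul, hc, one_mul])
    hmc
    (by
      intro b
      obtain ⟨u, hu⟩ := hs (S (c • 1) * b)
      refine ⟨d • u, ?_⟩
      change m * S (c • d • u) = b
      rw [smul_smul, hcd, one_smul, hu, ← mul_assoc, hmc, one_mul]) hy
  refine ⟨x, hx, fun u => ?_⟩
  have := hxu (d • u)
  simp only [smul_smul, hcd, one_smul] at this
  exact this

theorem vanish {A : Subalgebra ℂ C(X, ℂ)}
    (hsep : ∀ x x' : X, x ≠ x' → ∃ f ∈ A, f x ≠ f x') {x x' xb : X} (h1 : x ≠ x') (h2 : x ≠ xb) :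
    ∃ v : A, v.1 x ≠ 0 ∧ v.1 x' = 0 ∧ v.1 xb = 0 := by
  obtain ⟨f, hf, hf1⟩ := hsep x x' h1
  obtain ⟨g, hg, hg1⟩ := hsep x xb h2
  refine ⟨((⟨f, hf⟩ : A) - (f x') • 1) * ((⟨g, hg⟩ : A) - (g xb) • 1), ?_, ?_, ?_⟩
  · change (f x - f x' * 1) * (g x - g xb * 1) ≠ 0
    rw [mul_one, mul_one]
    exact mul_ne_zero (sub_ne_zero.2 hf1) (sub_ne_zero.2 hg1)
  · change (f x' - f x' * 1) * (g x' - g xb * 1) = 0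
    ring
  · change (f xb - f x' * 1) * (g xb - g xb * 1) = 0
    ring

theorem sepRe {A : Subalgebra ℂ C(X, ℂ)}
    (hsep : ∀ x x' : X, x ≠ x' → ∃ f ∈ A, f x ≠ f x') {x x' : X}
    (h : ∀ u : A, (u.1 x).re = (u.1 x').re) : x = x' := by
  by_contra hne
  obtain ⟨f, hf, hfne⟩ := hsep x x' hne
  apply hfne
  let u : A := ⟨f, hf⟩
  have e2 := h (Complex.I • u)
  change (Complex.I * u.1 x).re = (Complex.I * u.1 x').re at e2
  rw [Complex.I_mul_re, Complex.I_mul_re, neg_inj] at e2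
  exact Complex.ext (h u) e2

theorem repS {Y : Type*} [TopologicalSpace Y] [CompactSpace Y]
    {A : Subalgebra ℂ C(X, ℂ)} {B : Subalgebra ℂ C(Y, ℂ)}
    (hsep : ∀ x x' : X, x ≠ x' → ∃ f ∈ A, f x ≠ f x') (S : A → B)
    (hadd : ∀ u v, S (u + v) = S u + S v) (hsm : ∀ (t : ℝ) u, S ((t : ℂ) • u) = (t : ℂ) • S u)
    (hn : ∀ u, ‖S u‖ = ‖u‖) (hs : Function.Surjective S) (hS1 : S 1 = 1)
    (hj : S (Complex.I • 1) * S (Complex.I • 1) = -1) {y : Y} (hy : PE B {y}) :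
    ∃ x, PE A {x} ∧ (((S (Complex.I • 1)).1 y = Complex.I ∧ ∀ u : A, (S u).1 y = u.1 x) ∨
      ((S (Complex.I • 1)).1 y = -Complex.I ∧ ∀ u : A, (S u).1 y = (starRingEnd ℂ) (u.1 x))) := by
  set j := S (Complex.I • 1) with hjdef
  have hjj : ∀ z, j.1 z * j.1 z = -1 := fun z => congrArg (fun b : B => b.1 z) hj
  have hjI : ∀ z, j.1 z = Complex.I ∨ j.1 z = -Complex.I := by
    intro z
    apply mul_self_eq_mul_self_iff.1
    rw [hjj, Complex.I_mul_I]
  have n34 : ∀ a : ℝ, |a| = 4 → ‖(3 / 5 : ℂ) + ((a / 5 : ℝ) : ℂ) * Complex.I‖ = 1 := by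
    intro a ha
    have e : ‖(3 / 5 : ℂ) + ((a / 5 : ℝ) : ℂ) * Complex.I‖ ^ 2 = 1 := by
      rw [Complex.sq_norm, Complex.normSq_apply]
      have ha2 : a * a = 16 := by rw [← abs_mul_abs_self, ha]; norm_num
      have r1 : ((3 / 5 : ℂ) + ((a / 5 : ℝ) : ℂ) * Complex.I).re = 3 / 5 := by
        rw [Complex.add_re, Complex.re_ofReal_mul, Complex.I_re]; norm_num
      have r2 : ((3 / 5 : ℂ) + ((a / 5 : ℝ) : ℂ) * Complex.I).im = a / 5 := by
        rw [Complex.add_im, Complex.im_ofReal_mul, Complex.I_im]; norm_num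
      rw [r1, r2]; nlinarith
    have e2 := norm_nonneg ((3 / 5 : ℂ) + ((a / 5 : ℝ) : ℂ) * Complex.I)
    nlinarith
  obtain ⟨x, hx, hxu⟩ := repc hsep S hadd hsm hn hs 1 1 1 norm_one (one_mul 1)
    (fun z => norm_one) (by rw [one_smul, hS1, one_mul]) hy
  obtain ⟨x', -, hxu'⟩ := repc hsep S hadd hsm hn hs Complex.I (-Complex.I) (-j) Complex.norm_I
    (by rw [mul_neg, Complex.I_mul_I, neg_neg])
    (by
      intro z
      change ‖-(j.1 z)‖ = 1
      rw [norm_neg]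
      rcases hjI z with h | h <;> rw [h]
      · exact Complex.norm_I
      · rw [norm_neg]; exact Complex.norm_I)
    (by
      rw [← hjdef]
      apply Subtype.ext
      apply ContinuousMap.ext
      intro z
      change -(j.1 z) * j.1 z = 1
      rw [neg_mul, hjj, neg_neg]) hy
  obtain ⟨xb, -, hxub⟩ := repc hsep S hadd hsm hn hs (((3 / 5 : ℝ) : ℂ) + ((4 / 5 : ℝ) : ℂ) * Complex.I)
    (((3 / 5 : ℝ) : ℂ) - ((4 / 5 : ℝ) : ℂ) * Complex.I) (((3 / 5 : ℝ) : ℂ) • 1 - ((4 / 5 : ℝ) : ℂ) • j)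
    (by
      have := n34 4 (by norm_num)
      push_cast at this ⊢
      exact this)
    (by push_cast; linear_combination (-16 / 25 : ℂ) * Complex.I_mul_I)
    (by
      intro z
      change ‖((3 / 5 : ℝ) : ℂ) * 1 - ((4 / 5 : ℝ) : ℂ) * j.1 z‖ = 1
      rcases hjI z with h | h <;> rw [h]
      · have := n34 (-4) (by norm_num)
        push_cast at this ⊢
        rw [← this]; congr 1; ring
      · have := n34 4 (by norm_num)
        push_cast at this ⊢
        rw [← this]; congr 1; ring)
    (by
      rw [add_smul, hadd, mul_smul, hsm, hsm, hS1, ← hjdef]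
      apply Subtype.ext
      apply ContinuousMap.ext
      intro z
      change (((3 / 5 : ℝ) : ℂ) * 1 - ((4 / 5 : ℝ) : ℂ) * j.1 z) *
        (((3 / 5 : ℝ) : ℂ) * 1 + ((4 / 5 : ℝ) : ℂ) * j.1 z) = 1
      push_cast
      linear_combination (-16 / 25 : ℂ) * hjj z) hy
  have a1 : ∀ u : A, (u.1 x).re = ((S u).1 y).re := by
    intro u
    have := hxu u
    change (1 * u.1 x).re = (1 * (S u).1 y).re at this
    rwa [one_mul, one_mul] at this
  have a2 : ∀ u : A, (u.1 x').im = (-(j.1 y) * (S u).1 y).re := by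
    intro u
    have := hxu' u
    rw [neg_mul, Complex.neg_re, Complex.I_mul_re, neg_neg] at this
    exact this
  have a3 : ∀ u : A, 3 * (u.1 xb).re + 4 * (u.1 xb).im = 3 * (u.1 x).re + 4 * (u.1 x').im := by
    intro u
    have := hxub u
    change _ = ((((3 / 5 : ℝ) : ℂ) * 1 - ((4 / 5 : ℝ) : ℂ) * j.1 y) * (S u).1 y).re at this
    have e1 : (((3 / 5 : ℝ) : ℂ) * 1 - ((4 / 5 : ℝ) : ℂ) * j.1 y) * (S u).1 y =
      ((3 / 5 : ℝ) : ℂ) * (S u).1 y + ((4 / 5 : ℝ) : ℂ) * (-(j.1 y) * (S u).1 y) := by ring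
    have e2 : (((3 / 5 : ℝ) : ℂ) - ((4 / 5 : ℝ) : ℂ) * Complex.I) * u.1 xb =
      ((3 / 5 : ℝ) : ℂ) * u.1 xb - ((4 / 5 : ℝ) : ℂ) * (Complex.I * u.1 xb) := by ring
    rw [e1, e2, Complex.add_re, Complex.sub_re, Complex.re_ofReal_mul, Complex.re_ofReal_mul,
      Complex.re_ofReal_mul, Complex.re_ofReal_mul, Complex.I_mul_re, ← a1, ← a2] at this
    linarith
  have hxx' : x = x' := by
    by_contra hne
    by_cases h2 : x = xb
    · apply hne
      apply sepRe hsep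
      intro u
      have := a3 (Complex.I • u)
      rw [← h2] at this
      change 3 * (Complex.I * u.1 x).re + 4 * (Complex.I * u.1 x).im =
        3 * (Complex.I * u.1 x).re + 4 * (Complex.I * u.1 x').im at this
      rw [Complex.I_mul_im, Complex.I_mul_im] at this
      linarith
    · obtain ⟨v, v1, v2, v3⟩ := vanish hsep hne h2
      apply v1
      have e1 := a3 v
      have e2 := a3 (Complex.I • v)
      change 3 * (Complex.I * v.1 xb).re + 4 * (Complex.I * v.1 xb).im =
        3 * (Complex.I * v.1 x).re + 4 * (Complex.I * v.1 x').im at e2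
      rw [v2, v3] at e1 e2
      rw [Complex.I_mul_re (v.1 x)] at e2
      simp only [mul_zero, Complex.zero_re, Complex.zero_im] at e1 e2
      apply Complex.ext
      · rw [Complex.zero_re]; linarith
      · rw [Complex.zero_im]; linarith
  rw [← hxx'] at a2
  refine ⟨x, hx, ?_⟩
  rcases hjI y with h | h
  · left
    refine ⟨h, fun u => Complex.ext (a1 u).symm ?_⟩
    rw [a2, h, neg_mul, Complex.neg_re, Complex.I_mul_re, neg_neg]
  · right
    refine ⟨h, fun u => Complex.ext ?_ ?_⟩
    · rw [Complex.conj_re, a1]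
    · rw [Complex.conj_im, a2, h, neg_neg, Complex.I_mul_re, neg_neg]

theorem re_inducing {A : Subalgebra ℂ C(X, ℂ)}
    (hsep : ∀ x x' : X, x ≠ x' → ∃ f ∈ A, f x ≠ f x') :
    Topology.IsInducing (fun (x : X) (u : A) => (u.1 x).re) := by
  have hc : Continuous (fun (x : X) (u : A) => (u.1 x).re) :=
    continuous_pi fun u => Complex.continuous_re.comp u.1.continuous
  exact (hc.isClosedEmbedding fun x x' h => sepRe hsep fun u => congrFun h u).isInducing

end fa

theorem stmt16 {X Y : Type*} [TopologicalSpace X] [CompactSpace X]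
    [TopologicalSpace Y] [CompactSpace Y]
    (A : Subalgebra ℂ C(X, ℂ)) (B : Subalgebra ℂ C(Y, ℂ))
    (hA : IsClosed (A : Set C(X, ℂ))) (hB : IsClosed (B : Set C(Y, ℂ)))
    (hAsep : ∀ x x' : X, x ≠ x' → ∃ f ∈ A, f x ≠ f x')
    (hBsep : ∀ y y' : Y, y ≠ y' → ∃ g ∈ B, g y ≠ g y')
    (T : (↥A)ˣ → (↥B)ˣ) (hsurj : Function.Surjective T)
    (h : ∀ f g : (↥A)ˣ, ‖(((T f * T g : (↥B)ˣ) : ↥B) : C(Y, ℂ)) - 1‖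
        = ‖(((f * g : (↥A)ˣ) : ↥A) : C(X, ℂ)) - 1‖) :
    (T 1) ^ 2 = 1 ∧
    ∃ φ : ↥(ChoquetBdry B) ≃ₜ ↥(ChoquetBdry A), ∃ K : Set ↥(ChoquetBdry B), IsClopen K ∧
      (∀ f : (↥A)ˣ, ∀ y : ↥(ChoquetBdry B),
        (y ∈ K → ((T f : ↥B) : C(Y, ℂ)) ↑y
            = ((T 1 : ↥B) : C(Y, ℂ)) ↑y * ((f : ↥A) : C(X, ℂ)) ↑(φ y)) ∧
        (y ∉ K → ((T f : ↥B) : C(Y, ℂ)) ↑y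
            = ((T 1 : ↥B) : C(Y, ℂ)) ↑y * (starRingEnd ℂ) (((f : ↥A) : C(X, ℂ)) ↑(φ y)))) ∧
      ∃ S : ↥A ≃+* ↥B,
        (∀ (r : ℝ) (a : ↥A), S (((r : ℂ)) • a) = ((r : ℂ)) • S a) ∧
        (∀ f : (↥A)ˣ, S (f : ↥A) = ((T f * (T 1)⁻¹ : (↥B)ˣ) : ↥B)) := by
  have hcA : CompleteSpace A := hA.completeSpace_coe
  have hcB : CompleteSpace B := hB.completeSpace_coe
  have hAB : ∀ f g : (↥A)ˣ, ‖((T f * T g : (↥B)ˣ) : ↥B) - 1‖ = ‖((f * g : (↥A)ˣ) : ↥A) - 1‖ := h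
  have hone : ∀ f g, f * g = 1 → T f * T g = 1 := by
    intro f g hfg
    have e := hAB f g
    rw [hfg, Units.val_one, sub_self, norm_zero] at e
    exact Units.ext (sub_eq_zero.1 (norm_eq_zero.1 e))
  have hinv : ∀ f, T f⁻¹ = (T f)⁻¹ := fun f => (inv_eq_of_mul_eq_one_right (hone f f⁻¹ (mul_inv_cancel f))).symm
  have hT1 : T 1 * T 1 = 1 := hone 1 1 (one_mul 1)
  have hinj : Function.Injective T := by
    intro f g hfg
    have e := hAB f g⁻¹
    rw [hinv, hfg, mul_inv_cancel, Units.val_one, sub_self, norm_zero] at e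
    have e2 : f * g⁻¹ = 1 := Units.ext (sub_eq_zero.1 (norm_eq_zero.1 e.symm))
    exact mul_inv_eq_one.1 e2
  let T' : (↥A)ˣ ≃ (↥B)ˣ := (Equiv.ofBijective T ⟨hinj, hsurj⟩).trans (Equiv.mulRight (T 1)⁻¹)
  have hT' : ∀ f, T' f = T f * (T 1)⁻¹ := fun f => rfl
  have hT'mul : ∀ f g, T' f * T' g = T f * T g := by
    intro f g
    have e : (T 1)⁻¹ * (T 1)⁻¹ = 1 := by rw [← mul_inv, hT1, inv_one]
    rw [hT', hT', mul_mul_mul_comm, e, mul_one]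
  have hT'1 : T' 1 = 1 := mul_inv_cancel (T 1)
  have hT'inv : ∀ f, (T' f)⁻¹ = T' f⁻¹ := by
    intro f
    apply inv_eq_of_mul_eq_one_right
    rw [hT'mul]
    exact hone _ _ (mul_inv_cancel f)
  obtain ⟨S, hadd, hsm, hn, hs, hSe⟩ := linearize T' hT'1 (by
    intro f g
    change ‖((T' f / T' g : (↥B)ˣ) : ↥B) - 1‖ = ‖((f / g : (↥A)ˣ) : ↥A) - 1‖
    rw [div_eq_mul_inv, div_eq_mul_inv, hT'inv, hT'mul]
    exact hAB _ _)
  have hexp : ∀ u, ‖(eU (S u) : B) - 1‖ = ‖(eU u : A) - 1‖ := by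
    intro u
    have e := hAB (eU u) 1
    rw [← hT'mul, hT'1, mul_one, mul_one, hSe] at e
    exact e
  obtain ⟨hS1, hj⟩ := structS S hadd hsm hn hs hexp
  have hrep : ∀ y : ↥(ChoquetBdry B), _ := fun y =>
    repS hAsep S hadd hsm hn hs hS1 hj (PE_of_mem_choquet y.2)
  choose φ0 hφ0 hφS using hrep
  have hsub : ∀ u v, S (u - v) = S u - S v := by
    intro u v
    have := hadd (u - v) v
    rw [sub_add_cancel] at this
    rw [this, add_sub_cancel_right]
  have hSinj : Function.Injective S := by
    intro u v huv
    have e := hn (u - v)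
    rw [hsub, huv, sub_self, norm_zero] at e
    exact sub_eq_zero.1 (norm_eq_zero.1 e.symm)
  have hre : ∀ (u : A) (y : ↥(ChoquetBdry B)), ((S u).1 y.1).re = (u.1 (φ0 y)).re := by
    intro u y
    rcases hφS y with ⟨-, e⟩ | ⟨-, e⟩
    · rw [e]
    · rw [e, Complex.conj_re]
  have hbext : ∀ b b' : B, (∀ y : ↥(ChoquetBdry B), b.1 y.1 = b'.1 y.1) → b = b' := by
    intro b b' hbb
    rw [← sub_eq_zero]
    apply boundary hBsep
    intro y hy
    exact sub_eq_zero.2 (hbb ⟨y, hy⟩)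
  have hmul : ∀ u v, S (u * v) = S u * S v := by
    intro u v
    apply hbext
    intro y
    change _ = (S u).1 y.1 * (S v).1 y.1
    rcases hφS y with ⟨-, e⟩ | ⟨-, e⟩
    · rw [e, e, e]; rfl
    · rw [e, e, e, ← map_mul]; rfl
  have hSexp : ∀ u, S (eU u : A) = (eU (S u) : B) := by
    intro u
    apply hbext
    intro y
    rw [eU_apply]
    rcases hφS y with ⟨-, e⟩ | ⟨-, e⟩
    · rw [e, e, eU_apply]
    · rw [e, e, eU_apply, Complex.exp_conj]
  let Se : ↥A ≃+* ↥B := { Equiv.ofBijective S ⟨hSinj, hs⟩ with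
    map_mul' := hmul
    map_add' := hadd }
  have hSe' : ∀ u, Se u = S u := fun u => rfl
  have nz : ∀ (f : (↥A)ˣ) x, (f : A).1 x ≠ 0 := by
    intro f x h0
    have e : (f : A).1 x * ((f⁻¹ : (↥A)ˣ) : A).1 x = 1 :=
      congrArg (fun a : A => a.1 x) (Units.mul_inv f)
    rw [h0, zero_mul] at e
    exact zero_ne_one e
  have hST : ∀ f : (↥A)ˣ, S (f : ↥A) = ((T f * (T 1)⁻¹ : (↥B)ˣ) : ↥B) := by
    intro f
    rw [← hT']
    let F : (↥A)ˣ := Units.map (Se.symm : ↥B →* ↥A) (T' f)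
    have hF : S (F : A) = (T' f : B) := Se.apply_symm_apply (T' f : B)
    have : (F : A) = f := by
      apply rigid hAsep _ _ (nz f) (nz F)
      intro u
      rw [← hn, hsub, hmul, hF, hSexp, hS1, ← hSe]
      have e := hAB f (eU u)
      rw [← hT'mul] at e
      exact e
    rw [← this, hF]
  have hφinj : Function.Injective φ0 := by
    intro y y' hyy
    apply Subtype.ext
    apply sepRe hBsep
    intro b
    obtain ⟨u, rfl⟩ := hs b
    rw [hre, hre, hyy]
  let φ1 : ↥(ChoquetBdry B) → ↥(ChoquetBdry A) := fun y => ⟨φ0 y, mem_choquet_of_PE (hφ0 y)⟩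
  have hφ1 : Function.Bijective φ1 := by
    refine ⟨fun y y' hyy => hφinj (congrArg Subtype.val hyy), fun x => ?_⟩
    have hsS : ∀ b, S (Se.symm b) = b := fun b => Se.apply_symm_apply b
    obtain ⟨y, hy, hyu⟩ := lemL hBsep (fun b => Se.symm b) (fun u v => map_add _ u v)
      (fun t u => by
        apply hSinj
        rw [hsS, hsm, hsS])
      (fun u => by rw [← hn, hsS]) (map_one _) Se.symm.surjective (PE_of_mem_choquet x.2)
    refine ⟨⟨y, mem_choquet_of_PE hy⟩, Subtype.ext ?_⟩
    apply sepRe hAsep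
    intro u
    change (u.1 (φ0 ⟨y, _⟩)).re = _
    rw [← hre]
    have e := hyu (S u)
    have e2 : Se.symm (S u) = u := Se.symm_apply_apply u
    simp only [e2] at e
    exact e
  let φe := Equiv.ofBijective φ1 hφ1
  have iA : Topology.IsInducing (fun (x : ↥(ChoquetBdry A)) (u : A) => (u.1 x.1).re) :=
    (re_inducing hAsep).comp Topology.IsInducing.subtypeVal
  have iB : Topology.IsInducing (fun (x : ↥(ChoquetBdry B)) (u : B) => (u.1 x.1).re) :=
    (re_inducing hBsep).comp Topology.IsInducing.subtypeVal
  let φ : ↥(ChoquetBdry B) ≃ₜ ↥(ChoquetBdry A) := 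
    { φe with
      continuous_toFun := by
        rw [iA.continuous_iff]
        refine continuous_pi fun u => ?_
        change Continuous fun y : ↥(ChoquetBdry B) => (u.1 (φ0 y)).re
        have : (fun y : ↥(ChoquetBdry B) => (u.1 (φ0 y)).re) = fun y => ((S u).1 y.1).re :=
          funext fun y => (hre u y).symm
        rw [this]
        exact Complex.continuous_re.comp ((S u).1.continuous.comp continuous_subtype_val)
      continuous_invFun := by
        rw [iB.continuous_iff]
        refine continuous_pi fun b => ?_
        obtain ⟨u, rfl⟩ := hs b
        change Continuous fun x : ↥(ChoquetBdry A) => ((S u).1 (φe.symm x).1).re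
        have : (fun x : ↥(ChoquetBdry A) => ((S u).1 (φe.symm x).1).re) = fun x => (u.1 x.1).re := by
          funext x
          rw [hre]
          have e : (φe (φe.symm x)).1 = x.1 := by rw [φe.apply_symm_apply]
          change (u.1 (φe (φe.symm x)).1).re = _
          rw [e]
        rw [this]
        exact Complex.continuous_re.comp (u.1.continuous.comp continuous_subtype_val) }
  have hII : Complex.I ≠ -Complex.I := by
    intro e
    have := congrArg Complex.im e
    rw [Complex.neg_im, Complex.I_im] at this
    norm_num at this
  have hTS : ∀ (f : (↥A)ˣ) (y : Y), (T f : B).1 y = (T 1 : B).1 y * (S f).1 y := by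
    intro f y
    rw [hST]
    have e : T f = T 1 * (T f * (T 1)⁻¹) := by rw [mul_comm (T f), mul_inv_cancel_left]
    exact congrArg (fun b : (↥B)ˣ => (b : B).1 y) e
  have hjc : Continuous fun y : ↥(ChoquetBdry B) => (S (Complex.I • 1)).1 y.1 :=
    (S (Complex.I • 1)).1.continuous.comp continuous_subtype_val
  refine ⟨by rw [sq]; exact hT1, φ, {y | (S (Complex.I • 1)).1 y.1 = Complex.I}, ⟨?_, ?_⟩, ?_,
    Se, hsm, hST⟩
  · exact isClosed_eq hjc continuous_const
  · rw [← isClosed_compl_iff]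
    have : {y : ↥(ChoquetBdry B) | (S (Complex.I • 1)).1 y.1 = Complex.I}ᶜ =
        {y : ↥(ChoquetBdry B) | (S (Complex.I • 1)).1 y.1 = -Complex.I} := by
      ext y
      constructor
      · intro hy
        rcases hφS y with ⟨e, -⟩ | ⟨e, -⟩
        · exact absurd e hy
        · exact e
      · intro hy hy'
        exact hII (hy'.symm.trans hy)
    rw [this]
    exact isClosed_eq hjc continuous_const
  · intro f y
    constructor
    · intro hy
      refine (hTS f y).trans ?_
      rcases hφS y with ⟨-, e⟩ | ⟨e, -⟩
      · rw [e]; rfl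
      · exact absurd (hy.symm.trans e) hII
    · intro hy
      refine (hTS f y).trans ?_
      rcases hφS y with ⟨e, -⟩ | ⟨-, e⟩
      · exact absurd e hy
      · rw [e]; rfl
end
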